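/- arXiv:math/0011140 — 4 statements merged into one kernel-verified Lean document; each statement's English description precedes it below -/
import Mathlib

section
/- Let A be a separable C*-algebra and let α be a flow on A. Then the following conditions are equivalent: (1) every sequence (t_n) in ℝ admits a subsequence (t_{n(k)}) and a *-automorphism φ of A such that ‖α_{t_{n(k)}}(x) − φ(x)‖ → 0 and ‖α_{−t_{n(k)}}(x) − φ^{−1}(x)‖ → 0 for every x ∈ A; (2) for each x ∈ A the set {α_t(x) : t ∈ ℝ} has compact closure in A; (3) there is a dense subset D of A such that for each x ∈ D the set {α_t(x) : t ∈ ℝ} has compact closure; (4) the linear span of the spectral subspaces A_p = {x ∈ A : α_t(x) = e^{ipt}·x for all t ∈ ℝ}, taken over all p ∈ ℝ, is dense in A; (5) there is an increasing sequence (V_n) of finite-dimensional linear subspaces of A whose union is dense in A and such that α_t(V_n) = V_n for all n and all t ∈ ℝ. -/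
open Filter Topology

theorem AddChar.star_eq_of_isometry {G H : Type*} [AddCommGroup G] [NormedAddCommGroup H]
    [InnerProductSpace ℂ H] [CompleteSpace H] (U : AddChar G (H →L[ℂ] H))
    (hU : ∀ g v, ‖U g v‖ = ‖v‖) (g : G) : star (U g) = U (-g) := by
  have h1 : star (U g) * U g = 1 :=
    (ContinuousLinearMap.norm_map_iff_adjoint_comp_self (U g)).1 (hU g)
  have h2 : U g * U (-g) = 1 := by
    rw [← AddChar.map_add_eq_mul, add_neg_cancel, AddChar.map_zero_eq_one]
  exact left_inv_eq_right_inv h1 h2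

section IntegratedForm

open MeasureTheory

variable {G H E : Type*} [TopologicalSpace G] [CompactSpace G] [MeasurableSpace G] [BorelSpace G]
  (μ : Measure G) [IsFiniteMeasure μ]

theorem ContinuousMap.integrable_smul_of_continuous [NormedAddCommGroup E] [NormedSpace ℂ E]
    (u : C(G, ℂ)) {f : G → E} (hf : Continuous f) : Integrable (fun g => u g • f g) μ :=
  (u.continuous.smul hf).integrable_of_hasCompactSupport (HasCompactSupport.of_compactSpace _)

variable [AddCommGroup G] [NormedAddCommGroup H] [InnerProductSpace ℂ H]

/-- The integrated form `v ↦ ∫ u(g) U(g) v dg` of a strongly continuous isometric representation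
`U`, as a bounded linear map in the weight `u`. -/
noncomputable def integratedForm (U : AddChar G (H →L[ℂ] H)) (hU : ∀ g v, ‖U g v‖ = ‖v‖)
    (hc : ∀ v, Continuous fun g => U g v) : C(G, ℂ) →L[ℂ] H →L[ℂ] H :=
  LinearMap.mkContinuous₂
    (LinearMap.mk₂ ℂ (fun u v => ∫ g, u g • U g v ∂μ)
      (fun u u' v => by
        simp only [ContinuousMap.add_apply, add_smul]
        exact integral_add (u.integrable_smul_of_continuous μ (hc v))
          (u'.integrable_smul_of_continuous μ (hc v)))
      (fun c u v => by
        simp only [ContinuousMap.smul_apply, smul_assoc]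
        exact integral_smul _ _)
      (fun u v v' => by
        simp only [map_add, smul_add]
        exact integral_add (u.integrable_smul_of_continuous μ (hc v))
          (u.integrable_smul_of_continuous μ (hc v')))
      (fun c u v => by
        simp only [map_smul, smul_comm _ c]
        exact integral_smul _ _))
    (μ.real Set.univ) (fun u v => by
      rw [LinearMap.mk₂_apply, mul_assoc, mul_comm]
      refine norm_integral_le_of_norm_le_const (ae_of_all _ fun g => ?_)
      rw [norm_smul, hU]
      gcongr
      exact u.norm_coe_le_norm g)

theorem integratedForm_apply (U : AddChar G (H →L[ℂ] H)) (hU : ∀ g v, ‖U g v‖ = ‖v‖)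
    (hc : ∀ v, Continuous fun g => U g v) (u : C(G, ℂ)) (v : H) :
    integratedForm μ U hU hc u v = ∫ g, u g • U g v ∂μ := rfl

variable [CompleteSpace H]

theorem commute_integratedForm (U : AddChar G (H →L[ℂ] H)) (hU : ∀ g v, ‖U g v‖ = ‖v‖)
    (hc : ∀ v, Continuous fun g => U g v) (u : C(G, ℂ)) {X : H →L[ℂ] H}
    (hX : ∀ g, Commute (U g) X) : Commute (integratedForm μ U hU hc u) X := by
  ext v
  simp only [mul_apply_eq_comp, integratedForm_apply]
  rw [← X.integral_comp_comm (u.integrable_smul_of_continuous μ (hc v))]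
  congr 1 with g
  rw [map_smul, ← mul_apply_eq_comp, ← mul_apply_eq_comp, (hX g).eq]

theorem integratedForm_mul (U : AddChar G (H →L[ℂ] H))
    (hU : ∀ g v, ‖U g v‖ = ‖v‖) (hc : ∀ v, Continuous fun g => U g v) (u : C(G, ℂ))
    (T : H →L[ℂ] H) (hT : Continuous fun g => U g * T) :
    integratedForm μ U hU hc u * T = ∫ g, u g • (U g * T) ∂μ := by
  ext v
  rw [ContinuousLinearMap.integral_apply
    (u.integrable_smul_of_continuous μ hT)]
  rfl

variable [IsTopologicalAddGroup G]

theorem AddChar.mul_integratedForm [μ.IsAddLeftInvariant] (U : AddChar G (H →L[ℂ] H))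
    (hU : ∀ g v, ‖U g v‖ = ‖v‖) (hc : ∀ v, Continuous fun g => U g v) (u : C(G, ℂ)) (s : G) :
    U s * integratedForm μ U hU hc u =
      integratedForm μ U hU hc (u.comp ⟨fun g => -s + g, by fun_prop⟩) := by
  ext v
  simp only [mul_apply_eq_comp, integratedForm_apply]
  rw [← (U s).integral_comp_comm (u.integrable_smul_of_continuous μ (hc v)),
    ← integral_add_left_eq_self _ (-s)]
  congr 1 with g
  simp [← mul_apply_eq_comp, ← AddChar.map_add_eq_mul]

theorem AddChar.continuous_mul_integratedForm [μ.IsAddLeftInvariant] (U : AddChar G (H →L[ℂ] H))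
    (hU : ∀ g v, ‖U g v‖ = ‖v‖) (hc : ∀ v, Continuous fun g => U g v) (u : C(G, ℂ)) :
    Continuous fun s => U s * integratedForm μ U hU hc u := by
  simp only [AddChar.mul_integratedForm]
  refine (integratedForm μ U hU hc).continuous.comp ?_
  exact (ContinuousMap.curry ⟨fun p : G × G => u (-p.1 + p.2), by fun_prop⟩).continuous

/-- A nonzero integrated form is detected by a continuous character. -/
theorem exists_addChar_integral_ne_zero [μ.IsAddLeftInvariant] (U : AddChar G (H →L[ℂ] H))
    (hU : ∀ g v, ‖U g v‖ = ‖v‖) (hc : ∀ v, Continuous fun g => U g v) (u : C(G, ℂ))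
    (hu : integratedForm μ U hU hc u ≠ 0) :
    ∃ χ : AddChar G ℂ, Continuous χ ∧ ∫ g, u g * χ g ∂μ ≠ 0 := by
  let S : Set (H →L[ℂ] H) := Set.range U
  let B : StarSubalgebra ℂ (H →L[ℂ] H) :=
    StarSubalgebra.centralizer ℂ (StarSubalgebra.centralizer ℂ S)
  have hmemB {X : H →L[ℂ] H} : X ∈ B ↔ ∀ Y, (∀ g, Commute (U g) Y) → Commute X Y := by
    have hS : S ∪ star S = S := by
      refine Set.union_eq_left.2 ?_
      rintro X ⟨g, hg⟩
      exact ⟨-g, by rw [← AddChar.star_eq_of_isometry U hU, hg, star_star]⟩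
    rw [← SetLike.mem_coe, StarSubalgebra.coe_centralizer_centralizer, hS]
    simp only [Set.mem_centralizer_iff, S, Set.forall_mem_range]
    exact forall₂_congr fun Y _ => eq_comm
  have hUcomm (g h : G) : Commute (U g) (U h) := by
    rw [Commute, SemiconjBy, ← AddChar.map_add_eq_mul, ← AddChar.map_add_eq_mul, add_comm]
  have hUB (g : G) : U g ∈ B := hmemB.2 fun Y hY => hY g
  have hTB : integratedForm μ U hU hc u ∈ B :=
    hmemB.2 fun Y hY => commute_integratedForm μ U hU hc u hY
  have hBcomm (X Y : B) : X * Y = Y * X :=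
    Subtype.ext <| hmemB.1 X.2 _ fun g => (hmemB.1 Y.2 _ fun h => hUcomm h g).symm
  have hBclosed : IsClosed (B : Set (H →L[ℂ] H)) := by
    rw [StarSubalgebra.coe_centralizer]
    exact Set.isClosed_centralizer _
  let _ : CommCStarAlgebra B :=
    { StarSubalgebra.cstarAlgebra B with mul_comm := hBcomm }
  let T : B := ⟨integratedForm μ U hU hc u, hTB⟩
  have hT : T ≠ 0 := fun h => hu (congrArg Subtype.val h)
  obtain ⟨ψ, hψ⟩ : ∃ ψ : WeakDual.characterSpace ℂ B, ψ T ≠ 0 := by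
    by_contra! h
    refine hT ((gelfandTransform_isometry B).injective ?_)
    ext ψ
    simpa using h ψ
  let V : G → B := fun g => ⟨U g, hUB g⟩
  have hVT : Continuous fun g => V g * T :=
    (AddChar.continuous_mul_integratedForm μ U hU hc u).subtype_mk _
  let χ : AddChar G ℂ :=
    { toFun g := ψ (V g)
      map_zero_eq_one' := by
        have : V 0 = 1 := Subtype.ext U.map_zero_eq_one
        rw [this, map_one]
      map_add_eq_mul' g h := by
        have : V (g + h) = V g * V h := Subtype.ext (U.map_add_eq_mul g h)
        rw [this, map_mul] }
  have hχ (g : G) : ψ (V g * T) = χ g * ψ T := map_mul ψ _ _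
  have hψc : Continuous ψ := map_continuous ψ
  refine ⟨χ, ?_, ?_⟩
  · have : (χ : G → ℂ) = fun g => ψ (V g * T) * (ψ T)⁻¹ := by
      ext g
      rw [hχ, mul_inv_cancel_right₀ hψ]
    rw [this]
    exact (hψc.comp hVT).mul_const _
  · have hint : Integrable (fun g => u g • (V g * T)) μ :=
      u.integrable_smul_of_continuous μ hVT
    have hTT : T * T = ∫ g, u g • (V g * T) ∂μ := by
      apply Subtype.ext
      have := integratedForm_mul μ U hU hc u (integratedForm μ U hU hc u)
        (AddChar.continuous_mul_integratedForm μ U hU hc u)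
      refine this.trans ?_
      exact (B.toSubalgebra.toSubmodule.subtypeL.integral_comp_comm hint)
    have h := (WeakDual.CharacterSpace.toCLM ψ).integral_comp_comm hint
    rw [← hTT] at h
    have h2 : ∫ g, u g * (χ g * ψ T) ∂μ = ψ T * ψ T := by
      rw [← map_mul]
      refine Eq.trans ?_ h
      congr 1 with g
      rw [← hχ]
      exact (map_smul ψ (u g) (V g * T)).symm
    intro h0
    simp only [← mul_assoc] at h2
    rw [integral_mul_const, h0, zero_mul] at h2
    exact hψ (mul_self_eq_zero.1 h2.symm)

/-- The regular representation of `G` on `L²(G)` by translations. -/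
noncomputable def regularRep [μ.IsAddLeftInvariant] :
    AddChar G (Lp ℂ 2 μ →L[ℂ] Lp ℂ 2 μ) where
  toFun g := (Lp.compMeasurePreservingₗᵢ ℂ (g + ·)
    (measurePreserving_add_left μ g)).toContinuousLinearMap
  map_zero_eq_one' := by
    ext1 v
    change Lp.compMeasurePreserving ((0 : G) + ·) _ v = v
    simp only [zero_add]
    exact Lp.compMeasurePreserving_id_apply v
  map_add_eq_mul' g h := by
    ext1 v
    refine Eq.trans ?_ (Lp.compMeasurePreserving_comp_apply v (measurePreserving_add_left μ h)
      (measurePreserving_add_left μ g))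
    change Lp.compMeasurePreserving (g + h + ·) _ v = _
    congr 2
    ext k
    simp [add_left_comm, add_assoc]

omit [CompactSpace G] [IsFiniteMeasure μ] in
theorem norm_regularRep_apply [μ.IsAddLeftInvariant] (g : G) (v : Lp ℂ 2 μ) :
    ‖regularRep μ g v‖ = ‖v‖ :=
  Lp.norm_compMeasurePreserving v _

omit [IsFiniteMeasure μ] in
theorem continuous_regularRep_apply [T2Space G] [μ.IsAddLeftInvariant] [μ.Regular]
    (v : Lp ℂ 2 μ) : Continuous fun g => regularRep μ g v :=
  continuous_const.compMeasurePreservingLp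
    (ContinuousMap.curry ⟨fun p : G × G => p.1 + p.2, continuous_add⟩).continuous
    (measurePreserving_add_left μ) (by simp)

/-- A continuous function on a compact abelian group whose Fourier coefficients all vanish
is zero. -/
theorem ContinuousMap.eq_zero_of_forall_integral_addChar_eq_zero [T2Space G]
    [μ.IsAddLeftInvariant] [μ.Regular] [μ.IsOpenPosMeasure] (u : C(G, ℂ))
    (hu : ∀ χ : AddChar G ℂ, Continuous χ → ∫ g, u g * χ g ∂μ = 0) : u = 0 := by
  have hT : integratedForm μ (regularRep μ) (norm_regularRep_apply μ)
      (continuous_regularRep_apply μ) u = 0 := by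
    by_contra hT
    obtain ⟨χ, hχ, h⟩ := exists_addChar_integral_ne_zero μ _ _ _ u hT
    exact h (hu χ hχ)
  let w : G → C(G, ℂ) := fun g => (star u).comp ⟨fun h => g + h, by fun_prop⟩
  have hw : Continuous w :=
    (ContinuousMap.curry ⟨fun p : G × G => star (u (p.1 + p.2)), by fun_prop⟩).continuous
  have hint : Integrable (fun g => u g • w g) μ := u.integrable_smul_of_continuous μ hw
  have hzero : ∫ g, u g • w g ∂μ = 0 := by
    apply ContinuousMap.toLp_injective (p := 2) μ (𝕜 := ℂ)
    rw [map_zero, ← (ContinuousMap.toLp 2 μ ℂ).integral_comp_comm hint]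
    have := congrArg (fun T => T (ContinuousMap.toLp 2 μ ℂ (star u))) hT
    rw [integratedForm_apply] at this
    exact this
  have heval := (ContinuousMap.evalCLM ℂ (0 : G)).integral_comp_comm hint
  rw [hzero, map_zero] at heval
  have hsq : ∫ g, ‖u g‖ ^ 2 ∂μ = 0 := by
    apply Complex.ofReal_injective
    rw [← integral_complex_ofReal, Complex.ofReal_zero, ← heval]
    congr 1 with g
    simp [w, Complex.mul_conj']
  have hcont : Continuous fun g => ‖u g‖ ^ 2 := by fun_prop
  rw [integral_eq_zero_iff_of_nonneg (fun g => by positivity)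
    (hcont.integrable_of_hasCompactSupport (HasCompactSupport.of_compactSpace _)),
    hcont.ae_eq_iff_eq μ continuous_zero] at hsq
  ext g
  simpa using congrFun hsq g

end IntegratedForm

section OneParameter

open MeasureTheory

theorem AddChar.exists_eq_exp_of_continuous (χ : AddChar ℝ ℂ) (hχ : Continuous χ) :
    ∃ k : ℂ, ∀ t : ℝ, χ t = Complex.exp (k * t) := by
  have hprim (a t : ℝ) : HasDerivAt (fun b : ℝ => ∫ s in a..b, χ s) (χ t) t :=
    intervalIntegral.integral_hasDerivAt_right (hχ.intervalIntegrable _ _)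
      (hχ.stronglyMeasurableAtFilter _ _) hχ.continuousAt
  obtain ⟨δ, hδ⟩ : ∃ δ : ℝ, ∫ s in (0 : ℝ)..δ, χ s ≠ 0 := by
    by_contra! h
    have h0 := hprim 0 0
    simp only [h, AddChar.map_zero_eq_one] at h0
    exact zero_ne_one ((hasDerivAt_const (0 : ℝ) (0 : ℂ)).unique h0)
  set C := ∫ s in (0 : ℝ)..δ, χ s
  have hconv (t : ℝ) : χ t = ((∫ s in (0 : ℝ)..(δ + t), χ s) - ∫ s in (0 : ℝ)..t, χ s) / C := by
    rw [eq_div_iff hδ, intervalIntegral.integral_interval_sub_left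
      (hχ.intervalIntegrable _ _) (hχ.intervalIntegrable _ _),
      ← intervalIntegral.integral_const_mul]
    simp only [← AddChar.map_add_eq_mul]
    rw [intervalIntegral.integral_comp_add_left (fun s => χ s) t, add_zero, add_comm]
  let k : ℂ := (χ δ - 1) / C
  have hderiv (t : ℝ) : HasDerivAt χ (k * χ t) t := by
    have h1 : HasDerivAt (fun t : ℝ => ∫ s in (0 : ℝ)..(δ + t), χ s) (χ (δ + t)) t :=
      (hprim 0 (δ + t)).comp_const_add δ t
    have h2 := (h1.sub (hprim 0 t)).div_const C
    rw [AddChar.map_add_eq_mul] at h2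
    exact (h2.congr_of_eventuallyEq (.of_forall hconv)).congr_deriv (by ring)
  have hexp (t : ℝ) : HasDerivAt (fun t : ℝ => Complex.exp (-k * t))
      (Complex.exp (-k * t) * (-k)) t := by
    simpa using (((hasDerivAt_id (t : ℂ)).const_mul (-k)).cexp).comp_ofReal
  have hconst (t : ℝ) : χ t * Complex.exp (-k * t) = 1 := by
    have hd (t : ℝ) : HasDerivAt (fun t : ℝ => χ t * Complex.exp (-k * t)) 0 t :=
      ((hderiv t).mul (hexp t)).congr_deriv (by ring)
    have := is_const_of_deriv_eq_zero (fun t => (hd t).differentiableAt)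
      (fun t => (hd t).deriv) t 0
    simpa using this
  refine ⟨k, fun t => ?_⟩
  have := hconst t
  rw [neg_mul, Complex.exp_neg] at this
  exact (mul_inv_eq_one₀ (Complex.exp_ne_zero _)).1 this

theorem AddChar.exists_eq_exp_I_of_norm_eq_one (χ : AddChar ℝ ℂ) (hχ : Continuous χ)
    (hnorm : ∀ t, ‖χ t‖ = 1) : ∃ p : ℝ, ∀ t : ℝ, χ t = Complex.exp (Complex.I * p * t) := by
  obtain ⟨k, hk⟩ := χ.exists_eq_exp_of_continuous hχ
  have hre : k.re = 0 := by
    have := hnorm 1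
    rw [hk, Complex.norm_exp] at this
    simpa using this
  have : k = Complex.I * k.im := by
    apply Complex.ext <;> simp [hre]
  exact ⟨k.im, fun t => by rw [hk, ← this]⟩


/-- The span of the eigenvectors of a one-parameter group `U`. -/
def eigenspan {E : Type*} [NormedAddCommGroup E] [NormedSpace ℂ E]
    (U : AddChar ℝ (E →L[ℂ] E)) : Submodule ℂ E :=
  Submodule.span ℂ (⋃ p : ℝ, {x : E | ∀ t : ℝ, U t x = Complex.exp (Complex.I * p * t) • x})

variable {E : Type*} [NormedAddCommGroup E] [NormedSpace ℂ E]
  (U : AddChar ℝ (E →L[ℂ] E)) (hU : ∀ t x, ‖U t x‖ = ‖x‖)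

include hU in
theorem mem_eigenspan_of_addChar {χ : AddChar ℝ ℂ} (hχ : Continuous χ) {x : E}
    (hx : ∀ t, U t x = χ t • x) : x ∈ eigenspan U := by
  rcases eq_or_ne x 0 with rfl | hx0
  · exact zero_mem _
  have hnorm (t : ℝ) : ‖χ t‖ = 1 := by
    have := hU t x
    rw [hx, norm_smul] at this
    exact mul_eq_right₀ (norm_ne_zero_iff.2 hx0) |>.1 this
  obtain ⟨p, hp⟩ := χ.exists_eq_exp_I_of_norm_eq_one hχ hnorm
  exact Submodule.subset_span (Set.mem_iUnion.2 ⟨p, fun t => by rw [hx, hp]⟩)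

variable [CompleteSpace E]

include hU in
/-- If the orbit map of `U` factors through a compact abelian group, its values are limits of
combinations of eigenvectors. -/
theorem mem_closure_eigenspan_of_compact {G : Type*} [AddCommGroup G] [TopologicalSpace G]
    [IsTopologicalAddGroup G] [CompactSpace G] [T2Space G] {j : ℝ →+ G} (hj : Continuous j)
    {F : G → E} (hF : Continuous F) (hUF : ∀ t g, U t (F g) = F (j t + g)) (g : G) :
    F g ∈ (eigenspan U).topologicalClosure := by
  let _ : MeasurableSpace G := borel G
  have : BorelSpace G := ⟨rfl⟩
  let μ : Measure G := Measure.addHaar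
  by_contra hg
  obtain ⟨f, hfg, hf⟩ : ∃ f : E →L[ℂ] ℂ, f (F g) ≠ 0 ∧ ∀ x ∈ eigenspan U, f x = 0 := by
    have hnorm : ‖(eigenspan U).mkQ (F g)‖ ≠ 0 := fun h =>
      hg ((QuotientAddGroup.norm_mk_eq_zero_iff_mem_closure
        (S := (eigenspan U).toAddSubgroup)).1 h)
    obtain ⟨f, -, hf⟩ := exists_dual_vector ℂ _ hnorm
    refine ⟨f.comp (eigenspan U).mkQL, ?_, fun x hx => ?_⟩
    · rw [ContinuousLinearMap.comp_apply]
      exact fun h => hnorm (Complex.ofReal_injective (hf.symm.trans h))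
    · simp [(Submodule.Quotient.mk_eq_zero _).2 hx]
  have hzero : (⟨fun g => f (F g), by fun_prop⟩ : C(G, ℂ)) = 0 := by
    refine ContinuousMap.eq_zero_of_forall_integral_addChar_eq_zero μ _ fun χ hχ => ?_
    have hint : Integrable (fun g => χ g • F g) μ :=
      (⟨χ, hχ⟩ : C(G, ℂ)).integrable_smul_of_continuous μ hF
    have hmem : ∫ g, χ g • F g ∂μ ∈ eigenspan U := by
      refine mem_eigenspan_of_addChar U hU
        (χ := χ.compAddMonoidHom (j.comp (negAddMonoidHom : ℝ →+ ℝ)))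
        (hχ.comp (hj.comp continuous_neg)) fun t => ?_
      rw [← (U t).integral_comp_comm hint, ← integral_smul,
        ← integral_add_left_eq_self (fun h => _ • χ h • F h) (j t)]
      congr 1 with h
      rw [map_smul, hUF, smul_smul, AddChar.map_add_eq_mul, ← mul_assoc]
      simp [← AddChar.map_add_eq_mul]
    have := hf _ hmem
    rw [← f.integral_comp_comm hint] at this
    simpa [mul_comm] using this
  exact hfg (congrArg (fun u : C(G, ℂ) => u g) hzero)

/-- The additive group `ℝ` with the seminorm `t ↦ ‖U t x - x‖`. -/
def OrbitGroup (_hU : ∀ t x, ‖U t x‖ = ‖x‖) (_x : E) : Type := ℝ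

namespace OrbitGroup

variable (x : E)

instance : AddCommGroup (OrbitGroup U hU x) := inferInstanceAs (AddCommGroup ℝ)

/-- The identity map from `ℝ`. -/
def of : ℝ ≃+ OrbitGroup U hU x := AddEquiv.refl ℝ

/-- The seminorm `t ↦ ‖U t x - x‖`. -/
def seminorm : AddGroupSeminorm (OrbitGroup U hU x) where
  toFun t := ‖U ((of U hU x).symm t) x - x‖
  map_zero' := by simp
  add_le' s t := by
    rw [map_add, AddChar.map_add_eq_mul, mul_apply_eq_comp,
      ← sub_add_sub_cancel _ (U ((of U hU x).symm s) x), ← map_sub, add_comm]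
    refine (norm_add_le _ _).trans_eq ?_
    rw [hU]
  neg' t := by
    rw [← hU ((of U hU x).symm t), map_sub, ← mul_apply_eq_comp, ← AddChar.map_add_eq_mul,
      map_neg, add_neg_cancel, AddChar.map_zero_eq_one, one_apply_eq_self, norm_sub_rev]

noncomputable instance : SeminormedAddCommGroup (OrbitGroup U hU x) :=
  (seminorm U hU x).toSeminormedAddCommGroup

/-- The orbit map `t ↦ U t x`. -/
def orbit (t : OrbitGroup U hU x) : E := U ((of U hU x).symm t) x

omit [CompleteSpace E] in
theorem isometry_orbit : Isometry (orbit U hU x) := by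
  refine Isometry.of_dist_eq fun s t => ?_
  rw [dist_eq_norm, dist_eq_norm]
  change _ = ‖U ((of U hU x).symm (s - t)) x - x‖
  rw [← hU ((of U hU x).symm t) (_ - x), map_sub, ← mul_apply_eq_comp,
    ← AddChar.map_add_eq_mul, ← map_add, add_sub_cancel]
  rfl

end OrbitGroup

open OrbitGroup UniformSpace in
include hU in
/-- A vector with relatively compact orbit is a limit of combinations of eigenvectors. -/
theorem mem_closure_eigenspan_of_isCompact (hc : ∀ x, Continuous fun t => U t x) {x : E}
    (hx : IsCompact (closure (Set.range fun t => U t x))) :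
    x ∈ (eigenspan U).topologicalClosure := by
  have hiso := isometry_orbit U hU x
  have hof : Continuous (of U hU x) := by
    rw [hiso.isUniformInducing.isInducing.continuous_iff]
    exact hc x
  have htb : TotallyBounded (Set.univ : Set (OrbitGroup U hU x)) := by
    refine TotallyBounded.subset (fun t _ => ?_)
      (totallyBounded_preimage hiso.isUniformInducing hx.totallyBounded)
    exact subset_closure ⟨(of U hU x).symm t, rfl⟩
  have : CompactSpace (Completion (OrbitGroup U hU x)) := by
    refine ⟨?_⟩
    have h := htb.image (Completion.uniformContinuous_coe (OrbitGroup U hU x))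
    rw [Set.image_univ] at h
    rw [← Completion.denseRange_coe.closure_range]
    exact h.closure.isCompact_of_isClosed isClosed_closure
  let j : ℝ →+ Completion (OrbitGroup U hU x) :=
    (Completion.toCompl : OrbitGroup U hU x →+ _).comp (of U hU x).toAddMonoidHom
  let F : Completion (OrbitGroup U hU x) → E := Completion.extension (orbit U hU x)
  have hF : Continuous F := Completion.continuous_extension
  have hFcoe (t : OrbitGroup U hU x) : F t = orbit U hU x t :=
    Completion.extension_coe hiso.uniformContinuous t
  have hj : Continuous j := (Completion.continuous_coe _).comp hof
  have hUF (t : ℝ) (g) : U t (F g) = F (j t + g) := by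
    induction g using Completion.induction_on with
    | hp => exact isClosed_eq (by fun_prop) (by fun_prop)
    | ih s =>
      have : j t + (s : Completion (OrbitGroup U hU x)) = ↑(of U hU x t + s) :=
        (Completion.coe_add _ _).symm
      rw [this, hFcoe, hFcoe, orbit, orbit, map_add, AddChar.map_add_eq_mul]
      simp
  have := mem_closure_eigenspan_of_compact U hU hj hF hUF 0
  rwa [← Completion.coe_zero, hFcoe, orbit, map_zero, AddChar.map_zero_eq_one] at this

end OneParameter

section Limits

variable {A : Type*} [NormedRing A] [StarRing A] [CStarRing A] [NormedAlgebra ℂ A]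
  [CompleteSpace A]

theorem exists_tendsto_of_cauchySeq (β : ℕ → A ≃⋆ₐ[ℂ] A)
    (hβ : ∀ x, CauchySeq fun k => β k x) :
    ∃ φ : A →⋆ₐ[ℂ] A, ∀ x, Tendsto (fun k => β k x) atTop (𝓝 (φ x)) := by
  choose φ hφ using fun x => cauchySeq_tendsto_of_complete (hβ x)
  refine ⟨
    { toFun := φ
      map_one' := ?_
      map_mul' x y := ?_
      map_zero' := ?_
      map_add' x y := ?_
      commutes' c := ?_
      map_star' x := ?_ }, hφ⟩
  · exact tendsto_nhds_unique (hφ 1) (by simp)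
  · refine tendsto_nhds_unique (hφ _) ?_
    simpa only [map_mul] using (hφ x).mul (hφ y)
  · exact tendsto_nhds_unique (hφ 0) (by simp)
  · refine tendsto_nhds_unique (hφ _) ?_
    simpa only [map_add] using (hφ x).add (hφ y)
  · refine tendsto_nhds_unique (hφ _) ?_
    simp only [AlgHomClass.commutes]
    exact tendsto_const_nhds
  · refine tendsto_nhds_unique (hφ _) ?_
    simpa only [map_star] using (hφ x).star

variable [StarModule ℂ A]

theorem StarAlgEquiv.norm_apply_eq (φ : A ≃⋆ₐ[ℂ] A) (x : A) : ‖φ x‖ = ‖x‖ :=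
  let _ : CStarAlgebra A := {}
  StarAlgEquiv.norm_map φ x

/-- A sequence of automorphisms that is Cauchy at a dense set of points is Cauchy everywhere. -/
theorem cauchySeq_of_dense (β : ℕ → A ≃⋆ₐ[ℂ] A) {D : Set A} (hD : Dense D)
    (hβ : ∀ x ∈ D, CauchySeq fun k => β k x) (x : A) : CauchySeq fun k => β k x := by
  rw [Metric.cauchySeq_iff']
  intro ε hε
  obtain ⟨y, hxy, hy⟩ := Metric.dense_iff.1 hD x (ε / 3) (by positivity)
  obtain ⟨N, hN⟩ := Metric.cauchySeq_iff'.1 (hβ y hy) (ε / 3) (by positivity)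
  have hβxy (k : ℕ) : dist (β k x) (β k y) < ε / 3 := by
    rw [dist_eq_norm, ← map_sub, StarAlgEquiv.norm_apply_eq, ← dist_eq_norm, dist_comm]
    exact hxy
  refine ⟨N, fun k hk => ?_⟩
  have h := dist_triangle4 (β k x) (β k y) (β N y) (β N x)
  rw [dist_comm (β N y)] at h
  linarith [hN k hk, hβxy k, hβxy N]

/-- If a sequence of automorphisms and the sequence of inverses are pointwise Cauchy, the former
converges pointwise to an automorphism and the latter to its inverse. -/
theorem exists_starAlgEquiv_tendsto (β : ℕ → A ≃⋆ₐ[ℂ] A)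
    (hβ : ∀ x, CauchySeq fun k => β k x) (hβ' : ∀ x, CauchySeq fun k => (β k).symm x) :
    ∃ φ : A ≃⋆ₐ[ℂ] A, (∀ x, Tendsto (fun k => β k x) atTop (𝓝 (φ x))) ∧
      ∀ x, Tendsto (fun k => (β k).symm x) atTop (𝓝 (φ.symm x)) := by
  have key (γ : ℕ → A ≃⋆ₐ[ℂ] A) (φ ψ : A →⋆ₐ[ℂ] A)
      (hφ : ∀ x, Tendsto (fun k => γ k x) atTop (𝓝 (φ x)))
      (hψ : ∀ x, Tendsto (fun k => (γ k).symm x) atTop (𝓝 (ψ x))) (x : A) : ψ (φ x) = x := by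
    refine tendsto_nhds_unique (hψ (φ x)) ?_
    rw [tendsto_iff_norm_sub_tendsto_zero]
    refine (tendsto_iff_norm_sub_tendsto_zero.1 (hφ x)).congr fun k => ?_
    rw [← (γ k).norm_apply_eq ((γ k).symm (φ x) - x), map_sub, StarAlgEquiv.apply_symm_apply,
      norm_sub_rev]
  obtain ⟨φ, hφ⟩ := exists_tendsto_of_cauchySeq β hβ
  obtain ⟨ψ, hψ⟩ := exists_tendsto_of_cauchySeq (fun k => (β k).symm) hβ'
  exact ⟨.ofStarAlgHom φ ψ (StarAlgHom.ext (key β φ ψ hφ hψ))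
    (StarAlgHom.ext (key (fun k => (β k).symm) ψ φ hψ hφ)), hφ, hψ⟩

end Limits

theorem exists_seq_subset_closure_range {X : Type*} [PseudoMetricSpace X]
    [TopologicalSpace.SeparableSpace X] {S : Set X} (hS : S.Nonempty) :
    ∃ d : ℕ → X, (∀ i, d i ∈ S) ∧ S ⊆ closure (Set.range d) := by
  have := hS.to_subtype
  have := (TopologicalSpace.IsSeparable.of_separableSpace S).separableSpace
  refine ⟨fun i => TopologicalSpace.denseSeq S i, fun i => Subtype.coe_prop _, fun x hx => ?_⟩
  have := image_closure_subset_closure_image continuous_subtype_val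
    (Set.mem_image_of_mem Subtype.val (TopologicalSpace.denseRange_denseSeq S ⟨x, hx⟩))
  rwa [← Set.range_comp] at this

theorem isCompact_closure_range_of_forall_subseq {X ι : Type*} [PseudoMetricSpace X] (f : ι → X)
    (h : ∀ t : ℕ → ι, ∃ n : ℕ → ℕ, StrictMono n ∧ ∃ y, Tendsto (fun k => f (t (n k))) atTop (𝓝 y)) :
    IsCompact (closure (Set.range f)) := by
  refine IsSeqCompact.isCompact fun y hy => ?_
  have happrox (k : ℕ) : ∃ i, dist (y k) (f i) < 1 / ((k : ℝ) + 1) := by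
    simpa using Metric.mem_closure_iff.1 (hy k) (1 / ((k : ℝ) + 1)) (by positivity)
  choose t ht using happrox
  obtain ⟨n, hn, z, hz⟩ := h t
  refine ⟨z, mem_closure_of_tendsto hz (.of_forall fun k => Set.mem_range_self _), n, hn, ?_⟩
  refine (tendsto_iff_of_dist ?_).1 hz
  refine squeeze_zero (fun _ => dist_nonneg) (fun k => ?_)
    (tendsto_one_div_add_atTop_nhds_zero_nat.comp hn.tendsto_atTop)
  rw [dist_comm]
  exact (ht (n k)).le




/-- For a flow `α` on a separable C*-algebra `A`, the five
compactness conditions are equivalent. -/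
theorem compact_flow_tfae {A : Type*} [NormedRing A] [StarRing A] [CStarRing A]
    [NormedAlgebra ℂ A] [CompleteSpace A] [StarModule ℂ A]
    [TopologicalSpace.SeparableSpace A]
    (α : ℝ → A ≃⋆ₐ[ℂ] A)
    (hα0 : ∀ x : A, α 0 x = x)
    (hαadd : ∀ s t : ℝ, ∀ x : A, α (s + t) x = α s (α t x))
    (hαcont : ∀ x : A, Continuous fun t : ℝ => α t x) :
    List.TFAE
      [ -- (1) every sequence of times admits a subsequence along which the flow
        -- converges (together with the inverses) to an automorphism
        ∀ t : ℕ → ℝ, ∃ n : ℕ → ℕ, StrictMono n ∧ ∃ φ : A ≃⋆ₐ[ℂ] A,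
          (∀ x : A, Tendsto (fun k => ‖α (t (n k)) x - φ x‖) atTop (𝓝 0)) ∧
          (∀ x : A, Tendsto (fun k => ‖α (-(t (n k))) x - φ.symm x‖) atTop (𝓝 0)),
        -- (2) every orbit has compact closure
        ∀ x : A, IsCompact (closure (Set.range fun t : ℝ => α t x)),
        -- (3) orbits of a dense set of elements have compact closure
        ∃ D : Set A, Dense D ∧
          ∀ x ∈ D, IsCompact (closure (Set.range fun t : ℝ => α t x)),
        -- (4) the linear span of the spectral subspaces is dense
        Dense (↑(Submodule.span ℂ
          (⋃ p : ℝ, {x : A | ∀ t : ℝ, α t x = Complex.exp (Complex.I * p * t) • x}))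
            : Set A),
        -- (5) there is an increasing sequence of invariant finite-dimensional
        -- subspaces with dense union
        ∃ V : ℕ → Submodule ℂ A, (∀ n, FiniteDimensional ℂ (V n)) ∧ Monotone V ∧
          Dense (⋃ n, (V n : Set A)) ∧
          ∀ n, ∀ t : ℝ, (fun x : A => α t x) '' (V n : Set A) = (V n : Set A) ] := by
  let U : AddChar ℝ (A →L[ℂ] A) :=
    { toFun t := LinearMap.mkContinuous ((α t).toAlgEquiv.toLinearMap) 1 fun x => by
        simpa using ((α t).norm_apply_eq x).le
      map_zero_eq_one' := by ext x; exact hα0 x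
      map_add_eq_mul' s t := by ext x; exact hαadd s t x }
  have hU (t : ℝ) (x : A) : ‖U t x‖ = ‖x‖ := (α t).norm_apply_eq x
  have hsymm (t : ℝ) : α (-t) = (α t).symm := by
    ext x
    refine (α t).injective (Eq.trans ?_ ((α t).apply_symm_apply x).symm)
    change α t (α (-t) x) = x
    rw [← hαadd, add_neg_cancel, hα0]
  tfae_have 1 → 2 := fun h x => by
    refine isCompact_closure_range_of_forall_subseq _ fun t => ?_
    obtain ⟨n, hn, φ, hφ, -⟩ := h t
    exact ⟨n, hn, φ x, tendsto_iff_norm_sub_tendsto_zero.2 (hφ x)⟩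
  tfae_have 2 → 3 := fun h => ⟨Set.univ, dense_univ, fun x _ => h x⟩
  tfae_have 3 → 4 := fun ⟨D, hD, hDc⟩ => by
    refine dense_closure.1 (hD.mono fun x hx => ?_)
    exact mem_closure_eigenspan_of_isCompact U hU hαcont (hDc x hx)
  tfae_have 4 → 5 := fun h => by
    set S : Set A := ⋃ p : ℝ, {x : A | ∀ t : ℝ, α t x = Complex.exp (Complex.I * p * t) • x}
    have hS : S.Nonempty := ⟨0, Set.mem_iUnion.2 ⟨0, fun t => by simp⟩⟩
    obtain ⟨e, heS, hSe⟩ := exists_seq_subset_closure_range hS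
    let V (n : ℕ) : Submodule ℂ A := Submodule.span ℂ (e '' Set.Iio n)
    have hmono : Monotone V := fun m n hmn =>
      Submodule.span_mono (Set.image_mono (Set.Iio_subset_Iio hmn))
    have hmem (n : ℕ) (t : ℝ) {x : A} (hx : x ∈ V n) : α t x ∈ V n := by
      induction hx using Submodule.span_induction with
      | mem x hx =>
        obtain ⟨i, hi, rfl⟩ := hx
        obtain ⟨p, hp⟩ := Set.mem_iUnion.1 (heS i)
        rw [hp t]
        exact (V n).smul_mem _ (Submodule.subset_span ⟨i, hi, rfl⟩)
      | zero => simp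
      | add x y _ _ hx hy => rw [map_add]; exact add_mem hx hy
      | smul c x _ hx => rw [map_smul]; exact (V n).smul_mem c hx
    refine ⟨V, fun n => FiniteDimensional.span_of_finite ℂ ((Set.finite_Iio n).image e), hmono,
      dense_closure.1 (h.mono ?_), fun n t => ?_⟩
    · rw [← Submodule.coe_iSup_of_directed V hmono.directed_le,
        ← Submodule.topologicalClosure_coe, SetLike.coe_subset_coe, Submodule.span_le]
      refine hSe.trans (closure_mono (Set.range_subset_iff.2 fun i => ?_))
      exact Submodule.mem_iSup_of_mem (i + 1)
        (Submodule.subset_span ⟨i, Nat.lt_succ_self i, rfl⟩)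
    · refine Set.Subset.antisymm (Set.image_subset_iff.2 fun x hx => hmem n t hx) fun x hx => ?_
      exact ⟨α (-t) x, hmem n (-t) hx, by rw [hsymm]; exact (α t).apply_symm_apply x⟩
  tfae_have 5 → 3 := fun ⟨V, hfin, hmono, hdense, hinv⟩ => by
    refine ⟨_, hdense, fun x hx => ?_⟩
    obtain ⟨n, hn⟩ := Set.mem_iUnion.1 hx
    have := hfin n
    have : ProperSpace (V n) := FiniteDimensional.proper ℂ (V n)
    refine ((isCompact_closedBall (0 : V n) ‖x‖).image
      continuous_subtype_val).closure_of_subset ?_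
    rintro _ ⟨t, rfl⟩
    refine ⟨⟨α t x, (hinv n t).subset ⟨x, hn, rfl⟩⟩, ?_, rfl⟩
    simpa using ((α t).norm_apply_eq x).le
  tfae_have 3 → 1 := fun ⟨D, hD, hDc⟩ t => by
    obtain ⟨d, hdD, hd⟩ := exists_seq_subset_closure_range hD.nonempty
    replace hd : DenseRange d := dense_closure.1 (hD.mono hd)
    let K (i : ℕ) : Set A := closure (Set.range fun t => α t (d i))
    have hK : IsCompact (Set.univ.pi fun i => K i ×ˢ K i) :=
      isCompact_univ_pi fun i => (hDc _ (hdD i)).prod (hDc _ (hdD i))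
    obtain ⟨z, -, n, hn, hz⟩ := hK.tendsto_subseq
      (x := fun k i => (α (t k) (d i), α (-t k) (d i)))
      fun k i _ => ⟨subset_closure ⟨_, rfl⟩, subset_closure ⟨_, rfl⟩⟩
    have hz (i : ℕ) := (tendsto_pi_nhds.1 hz i)
    obtain ⟨φ, hφ, hφ'⟩ := exists_starAlgEquiv_tendsto (fun k => α (t (n k)))
      (cauchySeq_of_dense _ hd (Set.forall_mem_range.2 fun i =>
        ((continuous_fst.tendsto _).comp (hz i)).cauchySeq))
      (cauchySeq_of_dense _ hd (Set.forall_mem_range.2 fun i => by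
        have h := ((continuous_snd.tendsto _).comp (hz i)).cauchySeq
        simp only [← hsymm]
        exact h))
    refine ⟨n, hn, φ, fun x => tendsto_iff_norm_sub_tendsto_zero.1 (hφ x), fun x => ?_⟩
    simpa only [hsymm] using tendsto_iff_norm_sub_tendsto_zero.1 (hφ' x)
  tfae_finish
end

section
/- Let A be a separable C*-algebra and let (π_n) be a sequence of irreducible representations of A on Hilbert spaces H_n such that for m ≠ n the representations π_m and π_n are disjoint, meaning that the only bounded linear operator T : H_m → H_n satisfying T π_m(a) = π_n(a) T for all a ∈ A is T = 0. Let (S_n) be a sequence of dense subsets of ℝ. Then there exists a self-adjoint element h ∈ A such that for every n: the Hilbert space H_n has an orthonormal basis consisting of eigenvectors of π_n(h), every eigenvalue of π_n(h) belongs to S_n, and moreover every eigenvalue of π_n(h) has a one-dimensional eigenspace. -/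
open Filter Topology

section Schur
variable {A H : Type*} [NonUnitalCStarAlgebra A] [NormedAddCommGroup H] [InnerProductSpace ℂ H]
  [CompleteSpace H]

theorem exists_eq_algebraMap_of_isSelfAdjoint_of_commute (π : A →⋆ₙₐ[ℂ] (H →L[ℂ] H))
    (hirr : ∀ V : Submodule ℂ H, IsClosed (V : Set H) →
      (∀ a : A, ∀ ξ ∈ V, π a ξ ∈ V) → V = ⊥ ∨ V = ⊤)
    {T : H →L[ℂ] H} (hT : IsSelfAdjoint T) (hc : ∀ a, Commute (π a) T) :
    ∃ c : ℝ, T = algebraMap ℝ (H →L[ℂ] H) c := by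
  have key : ∀ s ∈ spectrum ℝ T, ∀ t ∈ spectrum ℝ T, ¬ s < t := by
    intro s hs t ht hst
    obtain ⟨m, hm1, hm2⟩ := exists_between hst
    set f : ℝ → ℝ := fun x ↦ max (x - m) 0
    set g : ℝ → ℝ := fun x ↦ max (m - x) 0
    have hf : Continuous f := by fun_prop
    have hg : Continuous g := by fun_prop
    have hfg : cfc f T * cfc g T = 0 := by
      rw [← cfc_mul f g T hf.continuousOn hg.continuousOn, ← cfc_zero ℝ T]
      congr 1
      ext x
      rcases le_total x m with h | h <;> simp [f, g, h]
    have hf0 : cfc f T ≠ 0 := by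
      intro h
      rw [← cfc_zero ℝ T] at h
      have := (cfc_eq_cfc_iff_eqOn (f := f) (g := 0) (a := T) (R := ℝ) (hf := hf.continuousOn)
        (hg := continuousOn_const)).1 h ht
      simp only [f, Pi.zero_apply] at this
      have h2 := le_max_left (t - m) 0
      linarith
    have hg0 : cfc g T ≠ 0 := by
      intro h
      rw [← cfc_zero ℝ T] at h
      have := (cfc_eq_cfc_iff_eqOn (f := g) (g := 0) (a := T) (R := ℝ) (hf := hg.continuousOn)
        (hg := continuousOn_const)).1 h hs
      simp only [g, Pi.zero_apply] at this
      have h2 := le_max_left (m - s) 0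
      linarith
    have hcf : ∀ a, Commute (cfc f T) (π a) := fun a ↦
      (IsSelfAdjoint.commute_cfc hT (hc a).symm f)
    rcases hirr (LinearMap.ker (cfc f T : H →L[ℂ] H).toLinearMap)
      (ContinuousLinearMap.isClosed_ker (cfc f T)) (fun a ξ hξ ↦ by
        have h1 : (cfc f T) (π a ξ) = π a (cfc f T ξ) := DFunLike.congr_fun (hcf a).eq ξ
        have h2 : cfc f T ξ = 0 := hξ
        change cfc f T (π a ξ) = 0
        rw [h1, h2, map_zero]) with h | h
    · apply hg0
      ext ξ
      have h1 : cfc g T ξ ∈ LinearMap.ker (cfc f T : H →L[ℂ] H).toLinearMap :=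
        DFunLike.congr_fun hfg ξ
      rw [h] at h1
      simpa using h1
    · apply hf0
      ext ξ
      have h1 : ξ ∈ LinearMap.ker (cfc f T : H →L[ℂ] H).toLinearMap := by rw [h]; trivial
      simpa using h1
  rcases (spectrum ℝ T).eq_empty_or_nonempty with h | ⟨c, hcs⟩
  · refine ⟨0, ?_⟩
    rw [← cfc_const (0 : ℝ) T]
    conv_lhs => rw [← cfc_id ℝ T]
    exact cfc_congr (by simp [h])
  · refine ⟨c, ?_⟩
    rw [← cfc_const c T]
    conv_lhs => rw [← cfc_id ℝ T]
    exact cfc_congr fun x hx ↦ le_antisymm (not_lt.1 (key c hcs x hx)) (not_lt.1 (key x hx c hcs))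

/-- **Schur's lemma** for irreducible representations of C*-algebras. -/
theorem exists_eq_smul_one_of_commute (π : A →⋆ₙₐ[ℂ] (H →L[ℂ] H))
    (hirr : ∀ V : Submodule ℂ H, IsClosed (V : Set H) →
      (∀ a : A, ∀ ξ ∈ V, π a ξ ∈ V) → V = ⊥ ∨ V = ⊤)
    {T : H →L[ℂ] H} (hc : ∀ a, Commute (π a) T) :
    ∃ c : ℂ, T = c • (1 : H →L[ℂ] H) := by
  have hs : ∀ a, Commute (π a) (star T) := fun a ↦ by
    have := (hc (star a)).star_star
    rwa [map_star, star_star] at this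
  have hre : ∀ a, Commute (π a) (realPart T : H →L[ℂ] H) := fun a ↦ by
    rw [realPart_apply_coe]
    exact ((hc a).add_right (hs a)).smul_right _
  have him : ∀ a, Commute (π a) (imaginaryPart T : H →L[ℂ] H) := fun a ↦ by
    rw [imaginaryPart_apply_coe]
    exact (((hc a).sub_right (hs a)).smul_right _).smul_right _
  obtain ⟨x, hx⟩ := exists_eq_algebraMap_of_isSelfAdjoint_of_commute π hirr (realPart T).2 hre
  obtain ⟨y, hy⟩ := exists_eq_algebraMap_of_isSelfAdjoint_of_commute π hirr (imaginaryPart T).2 him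
  refine ⟨x + Complex.I * y, ?_⟩
  rw [← realPart_add_I_smul_imaginaryPart T, hx, hy]
  ext ξ
  simp [Algebra.algebraMap_eq_smul_one, add_smul, mul_smul]

end Schur

section Bicommutant

theorem starProjection_apply_comm_of_mapsTo {E : Type*} [NormedAddCommGroup E]
    [InnerProductSpace ℂ E] (V : Submodule ℂ E) [V.HasOrthogonalProjection] {D D' : E →ₗ[ℂ] E}
    (hadj : ∀ x y, inner ℂ (D x) y = inner ℂ x (D' y)) (hD : ∀ x ∈ V, D x ∈ V)
    (hD' : ∀ x ∈ V, D' x ∈ V) (x : E) : V.starProjection (D x) = D (V.starProjection x) := by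
  refine (Submodule.eq_starProjection_of_mem_orthogonal
    (hD _ (V.starProjection_apply_mem x)) ?_)
  rw [← map_sub, Submodule.mem_orthogonal']
  intro u hu
  rw [hadj]
  exact (Submodule.mem_orthogonal' _ _).1 (V.sub_starProjection_mem_orthogonal x) _ (hD' u hu)

/-- The diagonal operator on a finite `ℓ²`-sum. -/
noncomputable def piDiag {ι : Type*} [Fintype ι] {E : ι → Type*}
    [∀ i, NormedAddCommGroup (E i)] [∀ i, InnerProductSpace ℂ (E i)] (T : ∀ i, E i →L[ℂ] E i) :
    PiLp 2 E →L[ℂ] PiLp 2 E :=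
  (PiLp.continuousLinearEquiv 2 ℂ E).symm.toContinuousLinearMap ∘L
    ContinuousLinearMap.pi fun i ↦ T i ∘L PiLp.proj 2 E i

section
variable {ι : Type*} [Fintype ι] {E : ι → Type*}
    [∀ i, NormedAddCommGroup (E i)] [∀ i, InnerProductSpace ℂ (E i)]

@[simp]
theorem piDiag_apply (T : ∀ i, E i →L[ℂ] E i) (x : PiLp 2 E) (i : ι) :
    piDiag T x i = T i (x i) := rfl

/-- An operator on a finite `ℓ²`-sum commutes with a diagonal operator as soon as its matrix
entries intertwine the diagonal entries. -/
theorem apply_piDiag_comm [DecidableEq ι] (P : PiLp 2 E →L[ℂ] PiLp 2 E) (T : ∀ i, E i →L[ℂ] E i)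
    (h : ∀ i j (x : E j), P (WithLp.toLp 2 (Pi.single j (T j x))) i =
      T i (P (WithLp.toLp 2 (Pi.single j x)) i)) (x : PiLp 2 E) :
    P (piDiag T x) = piDiag T (P x) := by
  have hsum : ∀ y : PiLp 2 E, y = ∑ j, WithLp.toLp 2 (Pi.single j (y j)) := by
    intro y
    ext i
    simp only [WithLp.ofLp_sum, Finset.sum_apply]
    rw [Finset.sum_eq_single i]
    · simp
    · intro j _ hj
      simp [Pi.single_eq_of_ne hj.symm]
    · simp
  have hx := hsum x
  have hTx := hsum (piDiag T x)
  ext i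
  rw [piDiag_apply, hTx]
  conv_rhs => rw [hx]
  simp only [map_sum, WithLp.ofLp_sum, Finset.sum_apply, piDiag_apply]
  exact Finset.sum_congr rfl fun j _ ↦ h i j (x j)

end

variable {A κ : Type*} [NonUnitalCStarAlgebra A] {H : κ → Type*} [∀ n, NormedAddCommGroup (H n)]
  [∀ n, InnerProductSpace ℂ (H n)] [∀ n, CompleteSpace (H n)]

theorem comp_eq_comp_of_intertwining (π : ∀ n, A →⋆ₙₐ[ℂ] (H n →L[ℂ] H n))
    (hirr : ∀ n, ∀ V : Submodule ℂ (H n), IsClosed (V : Set (H n)) →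
      (∀ a : A, ∀ ξ ∈ V, π n a ξ ∈ V) → V = ⊥ ∨ V = ⊤)
    (hdisj : ∀ m n, m ≠ n → ∀ T : H m →L[ℂ] H n,
      (∀ a : A, (T.comp (π m a) : H m →L[ℂ] H n) = (π n a).comp T) → T = 0)
    (b : ∀ n, H n →L[ℂ] H n) {m n : κ} (T : H m →L[ℂ] H n)
    (hT : ∀ a x, T (π m a x) = π n a (T x)) (x : H m) : T (b m x) = b n (T x) := by
  rcases eq_or_ne m n with rfl | hmn
  · obtain ⟨c, rfl⟩ := exists_eq_smul_one_of_commute (π m) (hirr m) (T := T)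
      fun a ↦ (ContinuousLinearMap.ext fun x ↦ hT a x : T * π m a = π m a * T).symm
    simp
  · rw [hdisj m n hmn T fun a ↦ ContinuousLinearMap.ext fun x ↦ hT a x]
    simp

theorem eq_zero_of_forall_apply_eq_zero {H : Type*} [NormedAddCommGroup H]
    [InnerProductSpace ℂ H] [CompleteSpace H] (π : A →⋆ₙₐ[ℂ] (H →L[ℂ] H))
    (hnondeg : Dense (↑(Submodule.span ℂ
      (Set.range fun p : A × H ↦ π p.1 p.2)) : Set H))
    {x : H} (hx : ∀ a, π a x = 0) : x = 0 := by
  refine hnondeg.eq_zero_of_inner_right (𝕜 := ℂ) fun v hv ↦ ?_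
  induction hv using Submodule.span_induction with
  | mem y hy =>
    obtain ⟨p, rfl⟩ := hy
    rw [← ContinuousLinearMap.adjoint_inner_right, ← ContinuousLinearMap.star_eq_adjoint,
      ← map_star, hx, inner_zero_right]
  | zero => simp
  | add y z _ _ hy hz => rw [inner_add_left, hy, hz, add_zero]
  | smul c y _ hy => rw [inner_smul_left, hy, mul_zero]

/-- The bicommutant theorem for pairwise disjoint irreducible representations, in dual form:
a normal functional that vanishes on `A` vanishes on the full product of the `B(H n)`. -/
theorem sum_inner_eq_zero_of_forall (π : ∀ n, A →⋆ₙₐ[ℂ] (H n →L[ℂ] H n))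
    (hnondeg : ∀ n, Dense (↑(Submodule.span ℂ
      (Set.range fun p : A × H n ↦ π n p.1 p.2)) : Set (H n)))
    (hirr : ∀ n, ∀ V : Submodule ℂ (H n), IsClosed (V : Set (H n)) →
      (∀ a : A, ∀ ξ ∈ V, π n a ξ ∈ V) → V = ⊥ ∨ V = ⊤)
    (hdisj : ∀ m n, m ≠ n → ∀ T : H m →L[ℂ] H n,
      (∀ a : A, (T.comp (π m a) : H m →L[ℂ] H n) = (π n a).comp T) → T = 0)
    {ι : Type*} [Fintype ι] (σ : ι → κ) (ξ η : ∀ i, H (σ i))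
    (h : ∀ a, ∑ i, inner ℂ (η i) (π (σ i) a (ξ i)) = 0) (b : ∀ n, H n →L[ℂ] H n) :
    ∑ i, inner ℂ (η i) (b (σ i) (ξ i)) = 0 := by
  classical
  let D (a : A) : PiLp 2 (fun i ↦ H (σ i)) →L[ℂ] PiLp 2 (fun i ↦ H (σ i)) :=
    piDiag fun i ↦ π (σ i) a
  let ξ' : PiLp 2 (fun i ↦ H (σ i)) := WithLp.toLp 2 ξ
  let η' : PiLp 2 (fun i ↦ H (σ i)) := WithLp.toLp 2 η
  have hDmul : ∀ a c x, D a (D c x) = D (a * c) x := fun a c x ↦ by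
    ext i; simp [D]
  have hDadj : ∀ a x y, inner ℂ (D a x) y = inner ℂ x (D (star a) y) := fun a x y ↦ by
    simp only [PiLp.inner_apply, D, piDiag_apply, map_star,
      ContinuousLinearMap.star_eq_adjoint, ContinuousLinearMap.adjoint_inner_right]
  let V₀ : Submodule ℂ (PiLp 2 (fun i ↦ H (σ i))) := Submodule.span ℂ (Set.range fun a ↦ D a ξ')
  let V := V₀.topologicalClosure
  have hξV : ∀ a, D a ξ' ∈ V := fun a ↦
    V₀.le_topologicalClosure (Submodule.subset_span ⟨a, rfl⟩)
  have hV : ∀ a, ∀ x ∈ V, D a x ∈ V := by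
    intro a x hx
    have h1 : V₀ ≤ V.comap (D a).toLinearMap := by
      refine Submodule.span_le.2 ?_
      rintro _ ⟨c, rfl⟩
      change D a (D c ξ') ∈ V
      rw [hDmul]
      exact hξV _
    exact V₀.topologicalClosure_minimal h1
      (V₀.isClosed_topologicalClosure.preimage (D a).continuous) hx
  have : CompleteSpace V := V₀.isClosed_topologicalClosure.completeSpace_coe
  have hPD : ∀ a x, V.starProjection (D a x) = D a (V.starProjection x) := fun a x ↦
    starProjection_apply_comm_of_mapsTo V (D := (D a).toLinearMap)
      (D' := (D (star a)).toLinearMap) (hDadj a) (hV a) (hV (star a)) x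
  have hPξ : V.starProjection ξ' = ξ' := by
    rw [eq_comm, ← sub_eq_zero]
    ext i
    refine eq_zero_of_forall_apply_eq_zero (π (σ i)) (hnondeg _) fun a ↦ ?_
    change D a (ξ' - V.starProjection ξ') i = 0
    rw [map_sub, ← hPD, Submodule.starProjection_eq_self_iff.2 (hξV a), sub_self]
    rfl
  have hPη : V.starProjection η' = 0 := by
    rw [Submodule.starProjection_apply_eq_zero_iff, Submodule.mem_orthogonal']
    have h1 : V₀ ≤ LinearMap.ker (innerSL ℂ η').toLinearMap := by
      refine Submodule.span_le.2 ?_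
      rintro _ ⟨a, rfl⟩
      change inner ℂ η' (D a ξ') = 0
      simpa [PiLp.inner_apply, D, η', ξ'] using h a
    intro u hu
    exact V₀.topologicalClosure_minimal h1 (ContinuousLinearMap.isClosed_ker _) hu
  have hPb : ∀ x, V.starProjection (piDiag (fun i ↦ b (σ i)) x) =
      piDiag (fun i ↦ b (σ i)) (V.starProjection x) := by
    refine apply_piDiag_comm _ _ fun i j x ↦ ?_
    let T : H (σ j) →L[ℂ] H (σ i) := PiLp.proj 2 (fun i ↦ H (σ i)) i ∘L V.starProjection ∘L
      (PiLp.continuousLinearEquiv 2 ℂ (fun i ↦ H (σ i))).symm.toContinuousLinearMap ∘L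
        ContinuousLinearMap.single ℂ (fun i ↦ H (σ i)) j
    refine comp_eq_comp_of_intertwining π hirr hdisj b T (fun a y ↦ ?_) x
    have h2 : (WithLp.toLp 2 (Pi.single j (π (σ j) a y)) : PiLp 2 (fun i ↦ H (σ i))) =
        D a (WithLp.toLp 2 (Pi.single j y)) := by
      ext k
      rcases eq_or_ne k j with rfl | hk
      · simp [D]
      · simp [D, Pi.single_eq_of_ne hk]
    change V.starProjection (WithLp.toLp 2 (Pi.single j (π (σ j) a y))) i =
      π (σ i) a (V.starProjection (WithLp.toLp 2 (Pi.single j y)) i)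
    rw [h2, hPD]
    rfl
  have h3 : inner ℂ η' (piDiag (fun i ↦ b (σ i)) ξ') = (0 : ℂ) := by
    rw [← hPξ, ← hPb, ← Submodule.inner_starProjection_left_eq_right, hPη, inner_zero_left]
  simpa [PiLp.inner_apply, η', ξ'] using h3

end Bicommutant

section Density

variable {A κ : Type*} [NonUnitalCStarAlgebra A] {H : κ → Type*} [∀ n, NormedAddCommGroup (H n)]
  [∀ n, InnerProductSpace ℂ (H n)] [∀ n, CompleteSpace (H n)]

theorem re_map_eq_zero_of_forall_lt {E : Type*} [AddCommGroup E] [Module ℂ E] (f : E →ₗ[ℂ] ℂ)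
    {u : ℝ} {x : E} (h : ∀ t : ℝ, (f ((t : ℂ) • x)).re < u) : (f x).re = 0 := by
  by_contra hne
  have := h (u / (f x).re)
  rw [map_smul, smul_eq_mul, Complex.re_ofReal_mul, div_mul_cancel₀ _ hne] at this
  exact lt_irrefl _ this

/-- Strong density of the self-adjoint part of `A` in the self-adjoint part of the product of the
`B(H n)`. -/
theorem exists_isSelfAdjoint_forall_norm_sub_lt (π : ∀ n, A →⋆ₙₐ[ℂ] (H n →L[ℂ] H n))
    (hnondeg : ∀ n, Dense (↑(Submodule.span ℂ
      (Set.range fun p : A × H n ↦ π n p.1 p.2)) : Set (H n)))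
    (hirr : ∀ n, ∀ V : Submodule ℂ (H n), IsClosed (V : Set (H n)) →
      (∀ a : A, ∀ ξ ∈ V, π n a ξ ∈ V) → V = ⊥ ∨ V = ⊤)
    (hdisj : ∀ m n, m ≠ n → ∀ T : H m →L[ℂ] H n,
      (∀ a : A, (T.comp (π m a) : H m →L[ℂ] H n) = (π n a).comp T) → T = 0)
    {ι : Type*} [Fintype ι] (σ : ι → κ) (ξ : ∀ i, H (σ i)) {b : ∀ n, H n →L[ℂ] H n}
    (hb : ∀ n, IsSelfAdjoint (b n)) {ε : ℝ} (hε : 0 < ε) :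
    ∃ a : A, IsSelfAdjoint a ∧ ∀ i, ‖π (σ i) a (ξ i) - b (σ i) (ξ i)‖ < ε := by
  let e (c : ∀ n, H n →L[ℂ] H n) : PiLp 2 (fun i ↦ H (σ i)) :=
    WithLp.toLp 2 fun i ↦ c (σ i) (ξ i)
  let C : Set (PiLp 2 (fun i ↦ H (σ i))) := (fun a ↦ e fun n ↦ π n a) '' {a | IsSelfAdjoint a}
  have hC : Convex ℝ C := by
    rintro _ ⟨a, ha, rfl⟩ _ ⟨c, hc, rfl⟩ s t - - -
    refine ⟨(s : ℂ) • a + (t : ℂ) • c, ?_, ?_⟩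
    · exact (IsSelfAdjoint.smul (Complex.conj_ofReal s) ha).add
        (IsSelfAdjoint.smul (Complex.conj_ofReal t) hc)
    · ext i
      simp [e, ← Complex.coe_smul]
  suffices h : e b ∈ closure C by
    obtain ⟨_, ⟨a, ha, rfl⟩, hlt⟩ := Metric.mem_closure_iff.1 h ε hε
    refine ⟨a, ha, fun i ↦ ?_⟩
    rw [dist_comm, dist_eq_norm] at hlt
    exact (PiLp.norm_apply_le (e (fun n ↦ π n a) - e b) i).trans_lt hlt
  by_contra hmem
  obtain ⟨f, u, hf, hu⟩ :=
    RCLike.geometric_hahn_banach_closed_point (𝕜 := ℂ) hC.closure isClosed_closure hmem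
  obtain ⟨η, rfl⟩ := (InnerProductSpace.toDual ℂ _).surjective f
  have hfe (c : ∀ n, H n →L[ℂ] H n) :
      InnerProductSpace.toDual ℂ _ η (e c) = ∑ i, inner ℂ (η i) (c (σ i) (ξ i)) := by
    simp [PiLp.inner_apply, e]
  have hC' : ∀ a : A, IsSelfAdjoint a →
      (InnerProductSpace.toDual ℂ _ η (e fun n ↦ π n a)).re < u := fun a ha ↦
    hf _ (subset_closure ⟨a, ha, rfl⟩)
  have hre : ∀ a : A, IsSelfAdjoint a →
      (∑ i, inner ℂ (η i) (π (σ i) a (ξ i))).re = 0 := by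
    intro a ha
    rw [← hfe fun n ↦ π n a]
    refine re_map_eq_zero_of_forall_lt
      (InnerProductSpace.toDual ℂ (PiLp 2 fun i ↦ H (σ i)) η).toLinearMap (u := u) fun t ↦ ?_
    have : (t : ℂ) • e (fun n ↦ π n a) = e fun n ↦ π n ((t : ℂ) • a) := by
      ext i; simp [e, -Complex.coe_smul]
    rw [this]
    exact hC' _ (IsSelfAdjoint.smul (Complex.conj_ofReal t) ha)
  have hu0 : 0 < u := by
    have := hC' 0 (.zero A)
    rw [hfe fun n ↦ π n 0] at this
    simpa using this
  have hswap (c : ∀ n, H n →L[ℂ] H n) : ∑ i, inner ℂ (ξ i) (c (σ i) (η i)) =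
      (starRingEnd ℂ) (∑ i, inner ℂ (η i) (star (c (σ i)) (ξ i))) := by
    rw [map_sum]
    refine Finset.sum_congr rfl fun i _ ↦ ?_
    rw [inner_conj_symm, ContinuousLinearMap.star_eq_adjoint,
      ContinuousLinearMap.adjoint_inner_left]
  have hsum : ∀ a : A, ∑ i, inner ℂ (η i) (π (σ i) a (ξ i)) +
      ∑ i, inner ℂ (ξ i) (π (σ i) a (η i)) = 0 := by
    intro a
    have h1 := hre _ (realPart a).2
    have h2 := hre _ (imaginaryPart a).2
    have h3 : ∀ i, π (σ i) a (ξ i) = π (σ i) (realPart a : A) (ξ i) +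
        Complex.I • π (σ i) (imaginaryPart a : A) (ξ i) := fun i ↦ by
      conv_lhs => rw [← realPart_add_I_smul_imaginaryPart a]
      simp
    have h4 : ∀ i, star (π (σ i) a) (ξ i) = π (σ i) (realPart a : A) (ξ i) -
        Complex.I • π (σ i) (imaginaryPart a : A) (ξ i) := fun i ↦ by
      conv_lhs => rw [← realPart_add_I_smul_imaginaryPart a, ← map_star]
      simp [(realPart a).2.star_eq, (imaginaryPart a).2.star_eq, sub_eq_add_neg]
    rw [hswap fun n ↦ π n a]
    simp only [h3, h4, inner_add_right, inner_sub_right, inner_smul_right,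
      Finset.sum_add_distrib, Finset.sum_sub_distrib, ← Finset.mul_sum]
    generalize (∑ i, inner ℂ (η i) (π (σ i) (realPart a : A) (ξ i))) = X at h1 ⊢
    generalize (∑ i, inner ℂ (η i) (π (σ i) (imaginaryPart a : A) (ξ i))) = Y at h2 ⊢
    apply Complex.ext <;> simp [h1, h2]
  have hzero : ∑ i, inner ℂ (η i) (b (σ i) (ξ i)) + ∑ i, inner ℂ (ξ i) (b (σ i) (η i)) = 0 := by
    have := sum_inner_eq_zero_of_forall π hnondeg hirr hdisj (Sum.elim σ σ)
      (Sum.rec ξ η) (Sum.rec η ξ) (fun a ↦ by rw [Fintype.sum_sum_type]; exact hsum a) b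
    rwa [Fintype.sum_sum_type] at this
  rw [hswap b] at hzero
  simp only [(hb _).star_eq] at hzero
  have h5 := congrArg Complex.re hzero
  rw [hfe] at hu
  simp only [Complex.add_re, Complex.conj_re, Complex.zero_re] at h5
  simp only [RCLike.re_to_complex] at hu
  linarith

end Density

section Kaplansky

/-- The rational function `2x / (1 + x²)`, a bijection of `[-1, 1]` of absolute value at most one. -/
noncomputable def cayleyFun (x : ℝ) : ℝ := 2 * x * (1 + x * x)⁻¹

theorem continuous_inv_one_add_mul_self : Continuous fun x : ℝ ↦ (1 + x * x)⁻¹ :=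
  (by fun_prop : Continuous fun x : ℝ ↦ 1 + x * x).inv₀ fun x ↦ by nlinarith [mul_self_nonneg x]

theorem continuous_cayleyFun : Continuous cayleyFun :=
  (continuous_const.mul continuous_id).mul continuous_inv_one_add_mul_self

theorem abs_cayleyFun_le (x : ℝ) : |cayleyFun x| ≤ 1 := by
  have h : 0 < 1 + x * x := by nlinarith [mul_self_nonneg x]
  rw [cayleyFun, ← div_eq_mul_inv, abs_div, abs_of_pos h, div_le_one h, abs_le]
  constructor <;> nlinarith [mul_self_nonneg (x + 1), mul_self_nonneg (x - 1)]

theorem cayleyFun_div_one_add_sqrt {x : ℝ} (hx : |x| ≤ 1) :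
    cayleyFun (x * (1 + √(1 - x * x))⁻¹) = x := by
  have h0 : 0 ≤ 1 - x * x := by nlinarith [abs_le.1 hx, abs_mul_abs_self x, abs_nonneg x]
  have h1 := Real.mul_self_sqrt h0
  have h2 := Real.sqrt_nonneg (1 - x * x)
  generalize √(1 - x * x) = s at h1 h2 ⊢
  have h3 : 0 < 1 + s := by linarith
  have h5 : 1 + x * (1 + s)⁻¹ * (x * (1 + s)⁻¹) = 2 * (1 + s)⁻¹ := by
    field_simp
    nlinarith
  rw [cayleyFun, h5]
  field_simp

section CStar
variable {M : Type*} [CStarAlgebra M]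

theorem cfc_inv_one_add_mul_self_mul {b : M} (hb : IsSelfAdjoint b) :
    cfc (fun x : ℝ ↦ (1 + x * x)⁻¹) b * (1 + b * b) = 1 ∧
      (1 + b * b) * cfc (fun x : ℝ ↦ (1 + x * x)⁻¹) b = 1 := by
  have h1 : 1 + b * b = cfc (fun x : ℝ ↦ 1 + x * x) b := by
    rw [cfc_const_add (1 : ℝ) (fun x ↦ x * x) b, cfc_mul (fun x ↦ x) (fun x ↦ x) b, cfc_id' ℝ b,
      map_one]
  have hc := continuous_inv_one_add_mul_self
  have h2 : ∀ x : ℝ, 1 + x * x ≠ 0 := fun x ↦ by nlinarith [mul_self_nonneg x]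
  rw [h1, ← cfc_mul _ _ b hc.continuousOn (by fun_prop),
    ← cfc_mul _ _ b (by fun_prop) hc.continuousOn, ← cfc_one ℝ b]
  exact ⟨cfc_congr fun x _ ↦ by simp [h2], cfc_congr fun x _ ↦ by simp [h2]⟩

theorem cfc_cayleyFun_eq {b : M} (hb : IsSelfAdjoint b) :
    cfc cayleyFun b = 2 * b * cfc (fun x : ℝ ↦ (1 + x * x)⁻¹) b ∧
      cfc cayleyFun b = cfc (fun x : ℝ ↦ (1 + x * x)⁻¹) b * (2 * b) := by
  have hc := continuous_inv_one_add_mul_self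
  have h1 : 2 * b = cfc (fun x : ℝ ↦ 2 * x) b := by
    rw [cfc_const_mul_id (2 : ℝ) b, two_smul, two_mul]
  rw [h1, ← cfc_mul _ _ b hc.continuousOn (by fun_prop),
    ← cfc_mul _ _ b (by fun_prop) hc.continuousOn]
  exact ⟨rfl, cfc_congr fun x _ ↦ mul_comm _ _⟩

theorem cfc_cayleyFun_sub {B b : M} (hB : IsSelfAdjoint B) (hb : IsSelfAdjoint b) :
    (2 : ℝ) • (cfc cayleyFun B - cfc cayleyFun b) =
      (4 : ℝ) • (cfc (fun x : ℝ ↦ (1 + x * x)⁻¹) B *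
        ((B - b) * cfc (fun x : ℝ ↦ (1 + x * x)⁻¹) b)) -
        cfc cayleyFun B * ((B - b) * cfc cayleyFun b) := by
  obtain ⟨h1, -⟩ := cfc_inv_one_add_mul_self_mul hB
  obtain ⟨-, h2⟩ := cfc_inv_one_add_mul_self_mul hb
  rw [(cfc_cayleyFun_eq hB).2, (cfc_cayleyFun_eq hb).1]
  generalize cfc (fun x : ℝ ↦ (1 + x * x)⁻¹) B = R at h1 ⊢
  generalize cfc (fun x : ℝ ↦ (1 + x * x)⁻¹) b = r at h2 ⊢
  have e1 : R * (2 * B) = R * (2 * B) * ((1 + b * b) * r) := by rw [h2, mul_one]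
  have e2 : 2 * b * r = R * (1 + B * B) * (2 * b * r) := by rw [h1, one_mul]
  have e3 : R * (2 * B) - 2 * b * r =
      R * (2 * B) * ((1 + b * b) * r) - R * (1 + B * B) * (2 * b * r) := by rw [← e1, ← e2]
  have e4 : (4 : ℝ) • (R * ((B - b) * r)) = 4 * (R * ((B - b) * r)) := by
    rw [show (4 : ℝ) = 2 + 2 by norm_num, add_smul, two_smul]
    noncomm_ring
  rw [e3, e4, two_smul]
  noncomm_ring

end CStar

variable {H : Type*} [NormedAddCommGroup H] [InnerProductSpace ℂ H] [CompleteSpace H]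

theorem norm_cfc_cayleyFun_sub_apply_le {B b : H →L[ℂ] H} (hB : IsSelfAdjoint B)
    (hb : IsSelfAdjoint b) (v : H) :
    ‖cfc cayleyFun B v - cfc cayleyFun b v‖ ≤
      2 * ‖B (cfc (fun x : ℝ ↦ (1 + x * x)⁻¹) b v) - b (cfc (fun x : ℝ ↦ (1 + x * x)⁻¹) b v)‖ +
        ‖B (cfc cayleyFun b v) - b (cfc cayleyFun b v)‖ := by
  have h := DFunLike.congr_fun (cfc_cayleyFun_sub hB hb) v
  have hR : ‖cfc (fun x : ℝ ↦ (1 + x * x)⁻¹) B‖ ≤ 1 := norm_cfc_le zero_le_one fun x _ ↦ by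
    have : 1 ≤ 1 + x * x := by nlinarith [mul_self_nonneg x]
    rw [Real.norm_eq_abs, abs_of_nonneg (by positivity)]
    exact inv_le_one_of_one_le₀ this
  have hG : ‖cfc cayleyFun B‖ ≤ 1 := norm_cfc_le zero_le_one fun x _ ↦ abs_cayleyFun_le x
  generalize cfc (fun x : ℝ ↦ (1 + x * x)⁻¹) b = r at h ⊢
  generalize cfc cayleyFun b = g at h ⊢
  set R := cfc (fun x : ℝ ↦ (1 + x * x)⁻¹) B
  set G := cfc cayleyFun B
  have h1 : ‖R (B (r v) - b (r v))‖ ≤ ‖B (r v) - b (r v)‖ := R.le_of_opNorm_le hR _ |>.trans_eq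
    (one_mul _)
  have h2 : ‖G (B (g v) - b (g v))‖ ≤ ‖B (g v) - b (g v)‖ := G.le_of_opNorm_le hG _ |>.trans_eq
    (one_mul _)
  have h3 : (2 : ℝ) • (G v - g v) = (4 : ℝ) • R (B (r v) - b (r v)) - G (B (g v) - b (g v)) := h
  have h4 := norm_sub_le ((4 : ℝ) • R (B (r v) - b (r v))) (G (B (g v) - b (g v)))
  rw [← h3, norm_smul, norm_smul, Real.norm_ofNat, Real.norm_ofNat] at h4
  have h5 := norm_nonneg (B (g v) - b (g v))
  linarith

variable {A κ : Type*} [NonUnitalCStarAlgebra A] {H : κ → Type*} [∀ n, NormedAddCommGroup (H n)]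
  [∀ n, InnerProductSpace ℂ (H n)] [∀ n, CompleteSpace (H n)]

/-- **Kaplansky's density theorem** for a family of pairwise disjoint irreducible
representations. -/
theorem exists_isSelfAdjoint_norm_le_forall_norm_sub_lt (π : ∀ n, A →⋆ₙₐ[ℂ] (H n →L[ℂ] H n))
    (hnondeg : ∀ n, Dense (↑(Submodule.span ℂ
      (Set.range fun p : A × H n ↦ π n p.1 p.2)) : Set (H n)))
    (hirr : ∀ n, ∀ V : Submodule ℂ (H n), IsClosed (V : Set (H n)) →
      (∀ a : A, ∀ ξ ∈ V, π n a ξ ∈ V) → V = ⊥ ∨ V = ⊤)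
    (hdisj : ∀ m n, m ≠ n → ∀ T : H m →L[ℂ] H n,
      (∀ a : A, (T.comp (π m a) : H m →L[ℂ] H n) = (π n a).comp T) → T = 0)
    {ι : Type*} [Fintype ι] (σ : ι → κ) (ξ : ∀ i, H (σ i)) {K : ∀ n, H n →L[ℂ] H n}
    (hK : ∀ n, IsSelfAdjoint (K n)) {c : ℝ} (hc : 0 < c) (hKc : ∀ n, ‖K n‖ ≤ c)
    {ε : ℝ} (hε : 0 < ε) :
    ∃ a : A, IsSelfAdjoint a ∧ ‖a‖ ≤ c ∧ ∀ i, ‖π (σ i) a (ξ i) - K (σ i) (ξ i)‖ < ε := by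
  let L n : H n →L[ℂ] H n := c⁻¹ • K n
  have hL : ∀ n, IsSelfAdjoint (L n) := fun n ↦ IsSelfAdjoint.smul (star_trivial _) (hK n)
  have hL1 : ∀ n, ‖L n‖ ≤ 1 := fun n ↦ by
    rw [norm_smul, norm_inv, Real.norm_of_nonneg hc.le]
    exact inv_mul_le_one_of_le₀ (hKc n) hc.le
  let φ : ℝ → ℝ := fun x ↦ x * (1 + √(1 - x * x))⁻¹
  have hφ : Continuous φ := by
    refine continuous_id.mul (Continuous.inv₀ (by fun_prop) fun x ↦ ?_)
    have := Real.sqrt_nonneg (1 - x * x)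
    linarith
  let b n : H n →L[ℂ] H n := cfc φ (L n)
  have hb : ∀ n, IsSelfAdjoint (b n) := fun n ↦ cfc_predicate φ (L n)
  have hgb : ∀ n, cfc cayleyFun (b n) = L n := fun n ↦ by
    rw [← cfc_comp cayleyFun φ (L n) (hL n) continuous_cayleyFun.continuousOn hφ.continuousOn]
    conv_rhs => rw [← cfc_id ℝ (L n)]
    refine cfc_congr fun x hx ↦ cayleyFun_div_one_add_sqrt ?_
    exact (spectrum.norm_le_norm_mul_of_mem hx).trans <|
      (mul_le_one₀ (hL1 n) (norm_nonneg _) ContinuousLinearMap.norm_id_le)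
  have hδ : 0 < ε / c / 3 := by positivity
  obtain ⟨a, ha, hab⟩ := exists_isSelfAdjoint_forall_norm_sub_lt π hnondeg hirr hdisj
    (Sum.elim σ σ) (Sum.rec (fun i ↦ cfc (fun x : ℝ ↦ (1 + x * x)⁻¹) (b (σ i)) (ξ i))
      (fun i ↦ L (σ i) (ξ i))) hb hδ
  refine ⟨c • cfcₙ cayleyFun a, IsSelfAdjoint.smul (star_trivial _) (cfcₙ_predicate _ a), ?_, ?_⟩
  · rw [norm_smul, Real.norm_of_nonneg hc.le]
    exact mul_le_of_le_one_right hc.le (norm_cfcₙ_le fun x _ ↦ abs_cayleyFun_le x)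
  · intro i
    have hπa : IsSelfAdjoint (π (σ i) a) := ha.map (π (σ i))
    have h1 : π (σ i) (c • cfcₙ cayleyFun a) = c • cfc cayleyFun (π (σ i) a) := by
      rw [← Complex.coe_smul, map_smul, Complex.coe_smul,
        NonUnitalStarAlgHomClass.map_cfcₙ (R := ℝ) (S := ℂ) (π (σ i)) cayleyFun a
          continuous_cayleyFun.continuousOn (by simp [cayleyFun])
          (AddMonoidHomClass.continuous_of_bound (π (σ i)) 1
            (by simpa using NonUnitalStarAlgHom.norm_apply_le (π (σ i)))) ha hπa,
        cfcₙ_eq_cfc continuous_cayleyFun.continuousOn (by simp [cayleyFun])]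
    have h2 : K (σ i) = c • L (σ i) := by simp [L, smul_smul, hc.ne']
    have h3 := norm_cfc_cayleyFun_sub_apply_le hπa (hb (σ i)) (ξ i)
    rw [hgb] at h3
    have h4 : ‖π (σ i) a (cfc (fun x : ℝ ↦ (1 + x * x)⁻¹) (b (σ i)) (ξ i)) -
      b (σ i) (cfc (fun x : ℝ ↦ (1 + x * x)⁻¹) (b (σ i)) (ξ i))‖ < _ := hab (Sum.inl i)
    have h5 : ‖π (σ i) a (L (σ i) (ξ i)) - b (σ i) (L (σ i) (ξ i))‖ < _ := hab (Sum.inr i)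
    rw [h1, h2, smul_apply, smul_apply, ← smul_sub,
      norm_smul, Real.norm_of_nonneg hc.le]
    calc c * ‖_‖ < c * (ε / c) := by gcongr; linarith
      _ = ε := mul_div_cancel₀ _ hc.ne'

end Kaplansky

section Transitivity

open InnerProductSpace in
/-- A self-adjoint operator that is small on a finite orthonormal set agrees on that set with a
self-adjoint operator that is small in norm. -/
theorem exists_isSelfAdjoint_eqOn_norm_le {H : Type*} [NormedAddCommGroup H]
    [InnerProductSpace ℂ H] [CompleteSpace H] {E : Finset H}
    (hE : Orthonormal ℂ ((↑) : E → H)) {D : H →L[ℂ] H} (hD : IsSelfAdjoint D) {η : ℝ}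
    (hDE : ∀ v ∈ E, ‖D v‖ ≤ η) :
    ∃ K : H →L[ℂ] H, IsSelfAdjoint K ∧ (∀ v ∈ E, K v = D v) ∧
      ‖K‖ ≤ (2 + E.card) * (E.card * η) := by
  classical
  let P : H →L[ℂ] H := ∑ v ∈ E, rankOne ℂ v v
  have hn : ∀ v ∈ E, ‖v‖ = 1 := fun v hv ↦ hE.1 ⟨v, hv⟩
  have hPs : star P = P := by
    simp [P, star_sum, ContinuousLinearMap.star_eq_adjoint]
  have hDs : star D = D := hD
  have hPE : ∀ v ∈ E, P v = v := fun v hv ↦ by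
    simp only [P, _root_.sum_apply, rankOne_apply]
    rw [Finset.sum_eq_single_of_mem v hv]
    · simp [inner_self_eq_norm_sq_to_K, hn v hv]
    · intro w hw hwv
      have := hE.2 (i := ⟨w, hw⟩) (j := ⟨v, hv⟩) (by simpa using hwv)
      simp only at this
      rw [this, zero_smul]
  have hDP : ‖D * P‖ ≤ E.card * η := by
    rw [← nsmul_eq_mul]
    simp only [P, Finset.mul_sum]
    refine norm_sum_le_of_le _ (f := fun v ↦ D * rankOne ℂ v v) (n := fun _ ↦ η) (fun v hv ↦ ?_)
      |>.trans_eq (by simp)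
    rw [ContinuousLinearMap.mul_def, comp_rankOne, norm_rankOne, hn v hv, mul_one]
    exact hDE v hv
  have hP : ‖P‖ ≤ E.card := by
    refine norm_sum_le_of_le _ (n := fun _ ↦ (1 : ℝ)) (fun v hv ↦ ?_) |>.trans_eq (by simp)
    rw [norm_rankOne, hn v hv, mul_one]
  have hPD : ‖P * D‖ = ‖D * P‖ := by
    rw [← norm_star, star_mul, hPs, hDs]
  refine ⟨D * P + P * D - P * (D * P), ?_, fun v hv ↦ ?_, ?_⟩
  · rw [IsSelfAdjoint, star_sub, star_add, star_mul, star_mul, star_mul, star_mul, hPs, hDs,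
      add_comm, mul_assoc]
  · change D (P v) + P (D v) - P (D (P v)) = D v
    rw [hPE v hv, add_sub_cancel_right]
  · calc _ ≤ ‖D * P‖ + ‖P * D‖ + ‖P‖ * ‖D * P‖ :=
        (norm_sub_le _ _).trans <| add_le_add (norm_add_le _ _) (norm_mul_le _ _)
      _ = (2 + ‖P‖) * ‖D * P‖ := by rw [hPD]; ring
      _ ≤ _ := by gcongr

variable {A κ : Type*} [NonUnitalCStarAlgebra A] {H : κ → Type*} [∀ n, NormedAddCommGroup (H n)]
  [∀ n, InnerProductSpace ℂ (H n)] [∀ n, CompleteSpace (H n)]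

theorem exists_isSelfAdjoint_approx_on_orthonormal (π : ∀ n, A →⋆ₙₐ[ℂ] (H n →L[ℂ] H n))
    (hnondeg : ∀ n, Dense (↑(Submodule.span ℂ
      (Set.range fun p : A × H n ↦ π n p.1 p.2)) : Set (H n)))
    (hirr : ∀ n, ∀ V : Submodule ℂ (H n), IsClosed (V : Set (H n)) →
      (∀ a : A, ∀ ξ ∈ V, π n a ξ ∈ V) → V = ⊥ ∨ V = ⊤)
    (hdisj : ∀ m n, m ≠ n → ∀ T : H m →L[ℂ] H n,
      (∀ a : A, (T.comp (π m a) : H m →L[ℂ] H n) = (π n a).comp T) → T = 0)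
    {I : Finset κ} {E : ∀ n, Finset (H n)} (hE : ∀ n, Orthonormal ℂ ((↑) : E n → H n))
    (hEI : ∀ n ∉ I, E n = ∅) {K : ∀ n, H n →L[ℂ] H n}
    (hK : ∀ n, IsSelfAdjoint (K n)) {c : ℝ} (hc : 0 < c) (hKc : ∀ n, ‖K n‖ ≤ c) :
    ∃ a : A, IsSelfAdjoint a ∧ ‖a‖ ≤ c ∧ ∃ K' : ∀ n, H n →L[ℂ] H n,
      (∀ n, IsSelfAdjoint (K' n)) ∧ (∀ n, ‖K' n‖ ≤ c / 2) ∧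
        ∀ n, ∀ v ∈ E n, K' n v = K n v - π n a v := by
  let M : ℕ := I.sup fun n ↦ (E n).card
  have hM : ∀ n, ((E n).card : ℝ) ≤ M := fun n ↦ by
    by_cases hn : n ∈ I
    · exact_mod_cast Finset.le_sup (f := fun n ↦ (E n).card) hn
    · simp [hEI n hn]
  let η : ℝ := c / 2 / ((2 + M) * (M + 1))
  have hη : 0 < η := by positivity
  obtain ⟨a, ha, hac, hab⟩ := exists_isSelfAdjoint_norm_le_forall_norm_sub_lt π hnondeg hirr hdisj
    (ι := Σ n : I, E n) (fun i ↦ i.1) (fun i ↦ (i.2 : H i.1)) hK hc hKc hη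
  refine ⟨a, ha, hac, ?_⟩
  have key : ∀ n, ∃ K' : H n →L[ℂ] H n, IsSelfAdjoint K' ∧
      (∀ v ∈ E n, K' v = (K n - π n a) v) ∧ ‖K'‖ ≤ (2 + (E n).card) * ((E n).card * η) := by
    refine fun n ↦ exists_isSelfAdjoint_eqOn_norm_le (hE n) ((hK n).sub (ha.map (π n)))
      fun v hv ↦ ?_
    have hn : n ∈ I := by
      by_contra hn
      simp [hEI n hn] at hv
    rw [sub_apply, norm_sub_rev]
    exact (hab ⟨⟨n, hn⟩, ⟨v, hv⟩⟩).le
  choose K' h1 h2 h3 using key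
  refine ⟨K', h1, fun n ↦ (h3 n).trans ?_, h2⟩
  calc _ ≤ (2 + (M : ℝ)) * ((M + 1) * η) := by
        gcongr
        · exact_mod_cast hM n
        · linarith [hM n]
    _ = c / 2 := by simp only [η]; field_simp

/-- **Kadison's transitivity theorem** for a family of pairwise disjoint irreducible
representations. -/
theorem exists_isSelfAdjoint_eqOn_orthonormal (π : ∀ n, A →⋆ₙₐ[ℂ] (H n →L[ℂ] H n))
    (hnondeg : ∀ n, Dense (↑(Submodule.span ℂ
      (Set.range fun p : A × H n ↦ π n p.1 p.2)) : Set (H n)))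
    (hirr : ∀ n, ∀ V : Submodule ℂ (H n), IsClosed (V : Set (H n)) →
      (∀ a : A, ∀ ξ ∈ V, π n a ξ ∈ V) → V = ⊥ ∨ V = ⊤)
    (hdisj : ∀ m n, m ≠ n → ∀ T : H m →L[ℂ] H n,
      (∀ a : A, (T.comp (π m a) : H m →L[ℂ] H n) = (π n a).comp T) → T = 0)
    {I : Finset κ} {E : ∀ n, Finset (H n)} (hE : ∀ n, Orthonormal ℂ ((↑) : E n → H n))
    (hEI : ∀ n ∉ I, E n = ∅) {K : ∀ n, H n →L[ℂ] H n}
    (hK : ∀ n, IsSelfAdjoint (K n)) {c : ℝ} (hc : 0 < c) (hKc : ∀ n, ‖K n‖ ≤ c) :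
    ∃ a : A, IsSelfAdjoint a ∧ ‖a‖ ≤ 2 * c ∧ ∀ n, ∀ v ∈ E n, π n a v = K n v := by
  let X (k : ℕ) : Type _ :=
    {L : ∀ n, H n →L[ℂ] H n // (∀ n, IsSelfAdjoint (L n)) ∧ ∀ n, ‖L n‖ ≤ c / 2 ^ k}
  have step : ∀ k (L : X k), ∃ a : A, IsSelfAdjoint a ∧ ‖a‖ ≤ c / 2 ^ k ∧ ∃ L' : X (k + 1),
      ∀ n, ∀ v ∈ E n, L'.1 n v = L.1 n v - π n a v := by
    intro k L
    obtain ⟨a, ha, hac, L', h1, h2, h3⟩ := exists_isSelfAdjoint_approx_on_orthonormal π hnondeg hirr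
      hdisj hE hEI L.2.1 (c := c / 2 ^ k) (by positivity) L.2.2
    exact ⟨a, ha, hac, ⟨L', h1, fun n ↦ (h2 n).trans_eq (by rw [pow_succ, div_div])⟩, h3⟩
  choose a ha hac L' hL' using step
  let L : ∀ k, X k := fun k ↦ Nat.rec ⟨K, hK, by simpa using hKc⟩ (fun k s ↦ L' k s) k
  have hbound : ∀ k, ‖a k (L k)‖ ≤ 2 * c / 2 / 2 ^ k := fun k ↦ by
    simpa using hac k (L k)
  have hsum : Summable fun k ↦ a k (L k) :=
    Summable.of_norm_bounded (summable_geometric_two' (2 * c)) hbound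
  refine ⟨∑' k, a k (L k), ?_, ?_, fun n v hv ↦ ?_⟩
  · rw [IsSelfAdjoint, tsum_star]
    exact tsum_congr fun k ↦ ha k (L k)
  · exact tsum_of_norm_bounded (hasSum_geometric_two' (2 * c)) hbound
  · have hpart : ∀ m, ∑ k ∈ Finset.range m, π n (a k (L k)) v = K n v - (L m).1 n v := fun m ↦ by
      induction m with
      | zero => simp [L]
      | succ m ih =>
        rw [Finset.sum_range_succ, ih, show (L (m + 1)).1 n v = (L m).1 n v - π n (a m (L m)) v from
          hL' m (L m) n v hv]
        abel
    have hlim : Tendsto (fun m ↦ (L m).1 n v) atTop (𝓝 0) := by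
      have h0 : Tendsto (fun m : ℕ ↦ c / 2 ^ m * ‖v‖) atTop (𝓝 0) := by
        have := (tendsto_pow_atTop_nhds_zero_of_lt_one (r := (1 / 2 : ℝ)) (by norm_num)
          (by norm_num)).const_mul c |>.mul_const ‖v‖
        simpa [div_eq_mul_inv] using this
      exact squeeze_zero_norm (fun m ↦ ((L m).1 n).le_of_opNorm_le ((L m).2.2 n) v) h0
    have hπ : Continuous (π n) := AddMonoidHomClass.continuous_of_bound (π n) 1
      (by simpa using NonUnitalStarAlgHom.norm_apply_le (π n))
    have h1 : HasSum (fun k ↦ π n (a k (L k)) v) (π n (∑' k, a k (L k)) v) :=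
      (hsum.hasSum.map (π n) hπ).map (ContinuousLinearMap.apply ℂ (H n) v)
        (ContinuousLinearMap.apply ℂ (H n) v).continuous
    refine tendsto_nhds_unique h1.tendsto_sum_nat ?_
    simp only [hpart]
    simpa using hlim.const_sub (K n v)

end Transitivity

section Staircase

/-- The piecewise linear ramp from `0` to `1` on the interval `[p, r]`. -/
noncomputable def ramp (p r x : ℝ) : ℝ := max 0 (min 1 ((x - p) / (r - p)))

theorem continuous_ramp (p r : ℝ) : Continuous (ramp p r) := by
  unfold ramp
  fun_prop

theorem ramp_nonneg (p r x : ℝ) : 0 ≤ ramp p r x := le_max_left _ _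

theorem ramp_le_one (p r x : ℝ) : ramp p r x ≤ 1 := max_le zero_le_one (min_le_left _ _)

theorem ramp_of_le {p r x : ℝ} (hpr : p < r) (hx : x ≤ p) : ramp p r x = 0 :=
  max_eq_left ((min_le_right _ _).trans (div_nonpos_of_nonpos_of_nonneg (by linarith)
    (by linarith)))

theorem ramp_of_ge {p r x : ℝ} (hpr : p < r) (hx : r ≤ x) : ramp p r x = 1 := by
  rw [ramp, min_eq_left ((one_le_div (by linarith)).2 (by linarith)), max_eq_right zero_le_one]

variable {t a b c : ℕ → ℝ} {w : ℝ}

/-- A continuous function with value `c j` between the middle thirds of the intervals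
`[a (j - 1), b (j - 1)]` and `[a j, b j]`. -/
noncomputable def staircase (a b c : ℕ → ℝ) : ℕ → ℝ → ℝ
  | 0, _ => c 0
  | M + 1, x => staircase a b c M x +
      (c (M + 1) - c M) * ramp (a M + (b M - a M) / 3) (a M + 2 * (b M - a M) / 3) x

theorem continuous_staircase (a b c : ℕ → ℝ) (M : ℕ) : Continuous (staircase a b c M) := by
  induction M with
  | zero => exact continuous_const
  | succ M ih => exact ih.add (continuous_const.mul (continuous_ramp _ _))

theorem staircase_of_ge (hta : ∀ j, t j < a j) (hab : ∀ j, a j < b j)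
    (hbt : ∀ j, b j < t (j + 1)) (M : ℕ) {x : ℝ} (hx : t M ≤ x) :
    staircase a b c M x = c M := by
  induction M with
  | zero => rfl
  | succ M ih =>
    have h1 := hab M
    have h2 := hbt M
    have h3 := hta M
    rw [staircase, ih (by linarith), ramp_of_ge (by linarith) (by linarith)]
    ring

theorem staircase_succ_of_ge (hta : ∀ j, t j < a j)
    (hab : ∀ j, a j < b j) (hbt : ∀ j, b j < t (j + 1)) (M : ℕ) {x : ℝ}
    (hx : a M + 2 * (b M - a M) / 3 ≤ x) :
    staircase a b c (M + 1) x = c (M + 1) := by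
  have h1 := hab M
  have h3 := hta M
  rw [staircase, staircase_of_ge hta hab hbt M (by linarith),
    ramp_of_ge (by linarith) (by linarith)]
  ring

theorem staircase_eq_of_le (ht : ∀ j, t (j + 1) = t j + w) (hw : 0 < w) (hta : ∀ j, t j < a j)
    (hab : ∀ j, a j < b j) {m M : ℕ} (hmM : m ≤ M) {x : ℝ}
    (hx : x ≤ a m + (b m - a m) / 3) (hx' : x ≤ t (m + 1)) :
    staircase a b c M x = staircase a b c m x := by
  have htm : Monotone t := monotone_nat_of_le_succ fun j ↦ by rw [ht]; linarith
  induction M, hmM using Nat.le_induction with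
  | base => rfl
  | succ M hM ih =>
    rw [staircase, ih, ramp_of_le (by linarith [hab M]), mul_zero, add_zero]
    rcases hM.eq_or_lt with rfl | hlt
    · exact hx
    · linarith [htm hlt, hta M, hab M]

theorem abs_staircase_sub_le (ht : ∀ j, t (j + 1) = t j + w) (hw : 0 < w) (hta : ∀ j, t j < a j)
    (hab : ∀ j, a j < b j) (hbt : ∀ j, b j < t (j + 1)) (hc : ∀ j, c j ∈ Set.Ioo (t j) (t (j + 1)))
    (M : ℕ) {x : ℝ} (hx0 : t 0 ≤ x) (hxM : x ≤ t M) : |staircase a b c M x - x| ≤ 2 * w := by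
  induction M with
  | zero =>
    have h1 := (hc 0).1
    have h2 := (hc 0).2
    rw [staircase, abs_le]
    constructor <;> linarith [ht 0]
  | succ M ih =>
    rw [staircase]
    rcases le_total x (t M) with h | h
    · rw [ramp_of_le (by linarith [hab M]) (by linarith [hab M, hta M]), mul_zero, add_zero]
      exact ih h
    · rw [staircase_of_ge hta hab hbt M h]
      have h1 := hc M
      have h2 := hc (M + 1)
      have h3 := ramp_nonneg (a M + (b M - a M) / 3) (a M + 2 * (b M - a M) / 3) x
      have h4 := ramp_le_one (a M + (b M - a M) / 3) (a M + 2 * (b M - a M) / 3) x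
      generalize ramp (a M + (b M - a M) / 3) (a M + 2 * (b M - a M) / 3) x = ρ at h3 h4
      rw [ht (M + 1), ht] at h2
      rw [ht] at h1 hxM
      have h5 : 0 < c (M + 1) - c M := by linarith [h1.2, h2.1]
      have h6 : c (M + 1) - c M ≤ 2 * w := by linarith [h1.1, h2.2]
      have h7 : (c (M + 1) - c M) * ρ ≤ c (M + 1) - c M := mul_le_of_le_one_right h5.le h4
      have h8 : 0 ≤ (c (M + 1) - c M) * ρ := by positivity
      rw [abs_le]
      constructor <;> linarith [h1.1, h1.2, h2.1, h2.2]

/-- A partition of unity `f j`, `g j` on `[t 1, t M]` adapted to a staircase function `q` close to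
the identity: `g j` lives on the short interval `[a j, b j]`, and `q` is constant on the support
of `f j`. -/
theorem exists_staircase_partition (ht : ∀ j, t (j + 1) = t j + w) (hw : 0 < w)
    (hta : ∀ j, t j < a j) (hab : ∀ j, a j < b j) (hbt : ∀ j, b j < t (j + 1))
    (hc : ∀ j, c j ∈ Set.Ioo (t j) (t (j + 1))) (M : ℕ) :
    ∃ (q : ℝ → ℝ) (f g : ℕ → ℝ → ℝ), Continuous q ∧ (∀ j, Continuous (f j)) ∧
      (∀ j, Continuous (g j)) ∧ (∀ x, t 0 ≤ x → x ≤ t M → |q x - x| ≤ 2 * w) ∧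
      (∀ j < M, ∀ x, q x * f j x = c (j + 1) * f j x) ∧
      (∀ j x, |g j x| ≤ 1) ∧ (∀ j, ∀ x ∉ Set.Icc (a j) (b j), g j x = 0) ∧
      ∀ x, t 1 ≤ x → x ≤ t M →
        ∑ j ∈ Finset.range M, f j x + ∑ j ∈ Finset.range M, g j x = 1 := by
  let α j := ramp (a j) (a j + (b j - a j) / 3)
  let β j := ramp (a j + 2 * (b j - a j) / 3) (b j)
  have hα0 : ∀ j x, x ≤ a j → α j x = 0 := fun j x hx ↦ ramp_of_le (by linarith [hab j]) hx
  have hα1 : ∀ j x, a j + (b j - a j) / 3 ≤ x → α j x = 1 :=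
    fun j x hx ↦ ramp_of_ge (by linarith [hab j]) hx
  have hβ0 : ∀ j x, x ≤ a j + 2 * (b j - a j) / 3 → β j x = 0 :=
    fun j x hx ↦ ramp_of_le (by linarith [hab j]) hx
  have hβ1 : ∀ j x, b j ≤ x → β j x = 1 := fun j x hx ↦ ramp_of_ge (by linarith [hab j]) hx
  refine ⟨staircase a b c M, fun j x ↦ β j x - α (j + 1) x, fun j x ↦ α j x - β j x,
    continuous_staircase a b c M,
    fun j ↦ (continuous_ramp _ _).sub (continuous_ramp _ _),
    fun j ↦ (continuous_ramp _ _).sub (continuous_ramp _ _),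
    fun x ↦ abs_staircase_sub_le ht hw hta hab hbt hc M, fun j hj x ↦ ?_, fun j x ↦ ?_,
    fun j x hx ↦ ?_, fun x hx1 hxM ↦ ?_⟩
  · beta_reduce
    rcases le_total x (a j + 2 * (b j - a j) / 3) with h | h
    · rw [hβ0 j x h, hα0 (j + 1) x (by linarith [hab j, hbt j, hta (j + 1)])]
      ring
    · rcases le_total x (a (j + 1) + (b (j + 1) - a (j + 1)) / 3) with h' | h'
      · rw [staircase_eq_of_le ht hw hta hab hj h' (by linarith [hbt (j + 1), hab (j + 1)]),
          staircase_succ_of_ge hta hab hbt j h]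
      · rw [hα1 _ _ h', hβ1 j x (by linarith [hab (j + 1), hbt j, hta (j + 1)])]
        ring
  · rw [abs_le]
    have h1 := ramp_nonneg (a j) (a j + (b j - a j) / 3) x
    have h2 := ramp_le_one (a j) (a j + (b j - a j) / 3) x
    have h3 := ramp_nonneg (a j + 2 * (b j - a j) / 3) (b j) x
    have h4 := ramp_le_one (a j + 2 * (b j - a j) / 3) (b j) x
    simp only [α, β]
    constructor <;> linarith
  · rw [Set.mem_Icc, not_and_or, not_le, not_le] at hx
    change α j x - β j x = 0
    rcases hx with hx | hx
    · rw [hα0 j x hx.le, hβ0 j x (by linarith [hab j]), sub_zero]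
    · rw [hα1 j x (by linarith [hab j]), hβ1 j x hx.le, sub_self]
  · rw [← Finset.sum_add_distrib]
    have : ∀ j, β j x - α (j + 1) x + (α j x - β j x) = α j x - α (j + 1) x := fun j ↦ by ring
    simp only [this]
    rw [Finset.sum_range_sub', hα1 0 x (by linarith [hab 0, hbt 0]), hα0 M x (by linarith [hta M]),
      sub_zero]

end Staircase

section WeylVonNeumann

variable {H : Type*} [NormedAddCommGroup H] [InnerProductSpace ℂ H] [CompleteSpace H]

theorem sum_norm_cfc_apply_sq_le {T : H →L[ℂ] H} (hT : IsSelfAdjoint T) {ι : Type*}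
    (s : Finset ι) {f : ι → ℝ → ℝ} (hf : ∀ i ∈ s, Continuous (f i))
    (hf1 : ∀ x, ∑ i ∈ s, f i x ^ 2 ≤ 1) (ξ : H) :
    ∑ i ∈ s, ‖cfc (f i) T ξ‖ ^ 2 ≤ ‖ξ‖ ^ 2 := by
  have h1 : ∀ i ∈ s, ‖cfc (f i) T ξ‖ ^ 2 = (inner ℂ ξ (cfc (fun x ↦ f i x ^ 2) T ξ)).re :=
    fun i hi ↦ by
      have hs : star (cfc (f i) T) = cfc (f i) T := cfc_predicate (f i) T
      rw [cfc_pow (f i) 2 T (hf i hi).continuousOn, pow_two (cfc (f i) T),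
        mul_apply_eq_comp, ← ContinuousLinearMap.adjoint_inner_left,
        ← ContinuousLinearMap.star_eq_adjoint, hs, inner_self_eq_norm_sq_to_K]
      norm_cast
  rw [Finset.sum_congr rfl h1, ← Complex.re_sum, ← inner_sum, ← _root_.sum_apply,
    ← cfc_sum (fun i x ↦ f i x ^ 2) T s fun i hi ↦ ((hf i hi).pow 2).continuousOn]
  have h2 : ‖cfc (∑ i ∈ s, fun x ↦ f i x ^ 2) T‖ ≤ 1 := norm_cfc_le zero_le_one fun x _ ↦ by
    rw [Finset.sum_apply, Real.norm_of_nonneg (Finset.sum_nonneg fun i _ ↦ sq_nonneg _)]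
    exact hf1 x
  calc _ ≤ ‖inner ℂ ξ (cfc (∑ i ∈ s, fun x ↦ f i x ^ 2) T ξ)‖ := Complex.re_le_norm _
    _ ≤ ‖ξ‖ * ‖cfc (∑ i ∈ s, fun x ↦ f i x ^ 2) T ξ‖ := norm_inner_le_norm _ _
    _ ≤ ‖ξ‖ * (1 * ‖ξ‖) := by
      gcongr
      exact ContinuousLinearMap.le_of_opNorm_le _ h2 ξ
    _ = ‖ξ‖ ^ 2 := by ring

/-- Every interval contains a subinterval whose spectral subspace for `T` nearly annihilates
`ξ`. -/
theorem exists_Icc_forall_norm_cfc_apply_le {T : H →L[ℂ] H} (hT : IsSelfAdjoint T) (ξ : H)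
    {δ : ℝ} (hδ : 0 < δ) {p r : ℝ} (hpr : p < r) :
    ∃ a b, p < a ∧ a < b ∧ b < r ∧ ∀ f : ℝ → ℝ, Continuous f → (∀ x, |f x| ≤ 1) →
      (∀ x ∉ Set.Icc a b, f x = 0) → ‖cfc f T ξ‖ ≤ δ := by
  by_contra! hcon
  obtain ⟨N, hN⟩ := exists_nat_gt (‖ξ‖ ^ 2 / δ ^ 2)
  have hδ2 : 0 < δ ^ 2 := by positivity
  rw [div_lt_iff₀ hδ2] at hN
  let d : ℝ := (r - p) / (2 * N + 2)
  have hd : 0 < d := div_pos (by linarith) (by positivity)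
  have hdN : (2 * N + 2) * d = r - p := mul_div_cancel₀ _ (by positivity)
  let a (i : ℕ) : ℝ := p + (2 * i + 1) * d
  have ha : ∀ i, p < a i := fun i ↦ lt_add_of_pos_right _ (by positivity)
  have hb : ∀ i, i < N → a i + d < r := fun i hi ↦ by
    have h1 : (i : ℝ) + 1 ≤ N := by exact_mod_cast hi
    have h2 : (2 * i + 2) * d < (2 * N + 2) * d :=
      mul_lt_mul_of_pos_right (by linarith) hd
    simp only [a]
    linarith
  have hf : ∀ i, ∃ f : ℝ → ℝ, i < N → Continuous f ∧ (∀ x, |f x| ≤ 1) ∧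
      (∀ x ∉ Set.Icc (a i) (a i + d), f x = 0) ∧ δ < ‖cfc f T ξ‖ := fun i ↦ by
    by_cases hi : i < N
    · obtain ⟨f, hf⟩ := hcon (a i) (a i + d) (ha i) (by linarith) (hb i hi)
      exact ⟨f, fun _ ↦ hf⟩
    · exact ⟨0, fun h ↦ absurd h hi⟩
  choose f hf using hf
  have hle := sum_norm_cfc_apply_sq_le hT (Finset.range N) (f := f)
    (fun i hi ↦ (hf i (Finset.mem_range.1 hi)).1) (fun x ↦ ?_) ξ
  · have : ∑ _i ∈ Finset.range N, δ ^ 2 ≤ ∑ i ∈ Finset.range N, ‖cfc (f i) T ξ‖ ^ 2 :=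
      Finset.sum_le_sum fun i hi ↦ by
        have := (hf i (Finset.mem_range.1 hi)).2.2.2
        gcongr
    rw [Finset.sum_const, Finset.card_range, nsmul_eq_mul] at this
    linarith
  · by_cases hx : ∃ i ∈ Finset.range N, f i x ≠ 0
    · obtain ⟨i, hi, hix⟩ := hx
      have hmem : ∀ k ∈ Finset.range N, f k x ≠ 0 → x ∈ Set.Icc (a k) (a k + d) := fun k hk hkx ↦
        not_not.1 fun h ↦ hkx ((hf k (Finset.mem_range.1 hk)).2.2.1 x h)
      have hlt : ∀ k l : ℕ, k < l → a k + d < a l := fun k l hkl ↦ by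
        have h1 : (k : ℝ) + 1 ≤ l := by exact_mod_cast hkl
        have h2 : (2 * k + 2) * d < (2 * l + 1) * d :=
          mul_lt_mul_of_pos_right (by linarith) hd
        simp only [a]
        linarith
      rw [Finset.sum_eq_single_of_mem i hi, sq_le_one_iff_abs_le_one]
      · exact (hf i (Finset.mem_range.1 hi)).2.1 x
      · intro k hk hki
        by_contra hkx
        have h1 := hmem i hi hix
        have h2 := hmem k hk (fun h ↦ hkx (by rw [h]; simp))
        rcases hki.lt_or_gt with h | h
        · linarith [hlt _ _ h, h1.1, h2.2]
        · linarith [hlt _ _ h, h2.1, h1.2]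
    · push Not at hx
      rw [Finset.sum_eq_zero fun i hi ↦ by rw [hx i hi]; simp]
      exact zero_le_one

end WeylVonNeumann

section EigenSystem

variable {H : Type*} [NormedAddCommGroup H] [InnerProductSpace ℂ H]

/-- A set of unit eigenvectors of `T` with pairwise distinct eigenvalues in `S`. -/
structure IsSimpleEigenSystem (S : Set ℝ) (T : H →L[ℂ] H) (E : Set H) : Prop where
  norm_eq_one : ∀ v ∈ E, ‖v‖ = 1
  exists_eigenvalue : ∀ v ∈ E, ∃ s ∈ S, T v = (s : ℂ) • v
  eq_of_eigenvalue : ∀ v ∈ E, ∀ w ∈ E, ∀ s : ℝ, T v = (s : ℂ) • v → T w = (s : ℂ) • w → v = w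

namespace IsSimpleEigenSystem
variable {S : Set ℝ} {T T' : H →L[ℂ] H} {E : Set H}

theorem empty (S : Set ℝ) (T : H →L[ℂ] H) : IsSimpleEigenSystem S T ∅ := by
  constructor <;> simp

theorem congr (h : IsSimpleEigenSystem S T E) (hT : ∀ v ∈ E, T' v = T v) :
    IsSimpleEigenSystem S T' E where
  norm_eq_one := h.norm_eq_one
  exists_eigenvalue v hv := by rw [hT v hv]; exact h.exists_eigenvalue v hv
  eq_of_eigenvalue v hv w hw := by rw [hT v hv, hT w hw]; exact h.eq_of_eigenvalue v hv w hw

theorem iUnion_of_monotone {E : ℕ → Set H} (hE : Monotone E)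
    (h : ∀ k, IsSimpleEigenSystem S T (E k)) : IsSimpleEigenSystem S T (⋃ k, E k) where
  norm_eq_one v hv := by
    obtain ⟨k, hk⟩ := Set.mem_iUnion.1 hv
    exact (h k).norm_eq_one v hk
  exists_eigenvalue v hv := by
    obtain ⟨k, hk⟩ := Set.mem_iUnion.1 hv
    exact (h k).exists_eigenvalue v hk
  eq_of_eigenvalue v hv w hw := by
    obtain ⟨k, hk⟩ := Set.mem_iUnion.1 hv
    obtain ⟨l, hl⟩ := Set.mem_iUnion.1 hw
    exact (h (max k l)).eq_of_eigenvalue v (hE (le_max_left k l) hk) w (hE (le_max_right k l) hl)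

theorem orthonormal [CompleteSpace H] (h : IsSimpleEigenSystem S T E) (hT : IsSelfAdjoint T) :
    Orthonormal ℂ ((↑) : E → H) := by
  refine ⟨fun v ↦ h.norm_eq_one v v.2, fun v w hvw ↦ ?_⟩
  obtain ⟨s, -, hs⟩ := h.exists_eigenvalue v v.2
  obtain ⟨r, -, hr⟩ := h.exists_eigenvalue w w.2
  have hsr : (s : ℂ) ≠ r := by
    intro hsr
    rw [← hsr] at hr
    exact hvw (Subtype.ext (h.eq_of_eigenvalue v v.2 w w.2 s hs hr))
  have h1 : inner ℂ (T v) (w : H) = inner ℂ (v : H) (T w) := hT.isSymmetric v w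
  rw [hs, hr, inner_smul_left, inner_smul_right, Complex.conj_ofReal] at h1
  by_contra hne
  exact hsr (mul_right_cancel₀ hne h1)

end IsSimpleEigenSystem

open Classical in
/-- The inductive step of the **Weyl–von Neumann theorem**: by a small self-adjoint perturbation,
a finite system of eigenvectors can be enlarged so as to approximate a given vector. -/
theorem IsSimpleEigenSystem.exists_perturbation [CompleteSpace H] {S : Set ℝ} (hS : Dense S)
    {T : H →L[ℂ] H} (hT : IsSelfAdjoint T) {E : Finset H} (hE : IsSimpleEigenSystem S T E) (ξ : H)
    {ε : ℝ} (hε : 0 < ε) :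
    ∃ K : H →L[ℂ] H, IsSelfAdjoint K ∧ ‖K‖ ≤ ε ∧ (∀ v ∈ E, K v = 0) ∧
      ∃ E' : Finset H, E ⊆ E' ∧ IsSimpleEigenSystem S (T + K) (E' : Set H) ∧
        ∃ w ∈ Submodule.span ℂ (E' : Set H), ‖ξ - w‖ ≤ ε := by
  let V : Submodule ℂ H := Submodule.span ℂ (E : Set H)
  have : FiniteDimensional ℂ V := FiniteDimensional.span_finset ℂ E
  let P := V.starProjection
  have hEV : ∀ v ∈ E, P v = v := fun v hv ↦
    Submodule.starProjection_eq_self_iff.2 (Submodule.subset_span hv)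
  choose! s hsS hs using hE.exists_eigenvalue
  have hTV : ∀ x ∈ V, T x ∈ V := by
    have : V ≤ V.comap T.toLinearMap := Submodule.span_le.2 fun v hv ↦ by
      change T v ∈ V
      rw [hs v hv]
      exact V.smul_mem _ (Submodule.subset_span hv)
    exact this
  have hPT : Commute T P := by
    ext x
    exact (starProjection_apply_comm_of_mapsTo V (D := T.toLinearMap) (D' := T.toLinearMap)
      (fun x y ↦ hT.isSymmetric x y) hTV hTV x).symm
  have hP : IsSelfAdjoint P := isSelfAdjoint_starProjection V
  have hcfc : ∀ f x, cfc f T (P x) = P (cfc f T x) := fun f x ↦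
    DFunLike.congr_fun (hPT.cfc_real f).eq x
  have hPP : ∀ x, P (x - P x) = 0 := fun x ↦ by
    rw [map_sub, Submodule.starProjection_eq_self_iff.2 (V.starProjection_apply_mem x), sub_self]
  let w : ℝ := ε / 2
  have hw : 0 < w := by positivity
  let t (j : ℕ) : ℝ := -‖T‖ - w + j * w
  have ht : ∀ j, t (j + 1) = t j + w := fun j ↦ by simp only [t]; push_cast; ring
  obtain ⟨M, hM⟩ : ∃ M : ℕ, ‖T‖ ≤ t M := by
    obtain ⟨M, hM⟩ := exists_nat_ge ((2 * ‖T‖ + w) / w)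
    refine ⟨M, ?_⟩
    rw [div_le_iff₀ hw] at hM
    simp only [t]
    linarith
  have hδ : 0 < ε / (M + 1) := by positivity
  have htlt : ∀ j, t j < t (j + 1) := fun j ↦ by rw [ht]; linarith
  choose a b hta hab hbt hg using fun j ↦
    exists_Icc_forall_norm_cfc_apply_le hT (ξ - P ξ) hδ (htlt j)
  have hcex : ∀ j, ∃ c ∈ S \ (E.image s : Set ℝ), c ∈ Set.Ioo (t j) (t (j + 1)) := fun j ↦
    (hS.sdiff_finset (E.image s)).exists_mem_open isOpen_Ioo (Set.nonempty_Ioo.2 (htlt j))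
  choose c hcS hct using hcex
  obtain ⟨q, f, g, hqc, hfc, hgc, hq, hqf, hg1, hg0, hfg⟩ :=
    exists_staircase_partition ht hw hta hab hbt hct M
  have hcinj : StrictMono c := strictMono_nat_of_lt_succ fun j ↦
    (hct j).2.trans (hct (j + 1)).1
  let Q := cfc q T
  let K := (Q - T) * (1 - P)
  have hspec : ∀ x ∈ spectrum ℝ T, |x| ≤ ‖T‖ := fun x hx ↦
    (spectrum.norm_le_norm_mul_of_mem hx).trans
      (mul_le_of_le_one_right (norm_nonneg _) ContinuousLinearMap.norm_id_le)
  have hQs : IsSelfAdjoint Q := cfc_predicate q T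
  have hQT : ‖Q - T‖ ≤ ε := by
    have h1 : Q - T = cfc (fun x ↦ q x - x) T := by
      rw [cfc_sub q (fun x ↦ x) T hqc.continuousOn (by fun_prop), cfc_id' ℝ T]
    rw [h1]
    refine norm_cfc_le hε.le fun x hx ↦ ?_
    have h2 := abs_le.1 (hspec x hx)
    refine (hq x ?_ (h2.2.trans hM)).trans_eq (by simp only [w]; ring)
    simp only [t]
    push_cast
    linarith
  let e (j : ℕ) : H := cfc (f j) T (ξ - P ξ)
  have hPe : ∀ j, P (e j) = 0 := fun j ↦ by rw [← hcfc, hPP, map_zero]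
  have hK0 : ∀ v ∈ E, K v = 0 := fun v hv ↦ by
    change (Q - T) (v - P v) = 0
    rw [hEV v hv, sub_self, map_zero]
  have hKe : ∀ j < M, (T + K) (e j) = (c (j + 1) : ℂ) • e j := fun j hj ↦ by
    have h1 : Q * cfc (f j) T = c (j + 1) • cfc (f j) T := by
      rw [← cfc_mul q (f j) T hqc.continuousOn (hfc j).continuousOn,
        ← cfc_smul (c (j + 1)) (f j) T (hfc j).continuousOn]
      exact cfc_congr fun x _ ↦ hqf j hj x
    change T (e j) + (Q (e j - P (e j)) - T (e j - P (e j))) = _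
    rw [hPe, sub_zero, add_sub_cancel, Complex.coe_smul]
    exact DFunLike.congr_fun h1 _
  let E₁ : Finset H := {j ∈ Finset.range M | e j ≠ 0}.image fun j ↦ ((‖e j‖⁻¹ : ℝ) : ℂ) • e j
  have hE₁ : ∀ v ∈ E₁, ∃ j < M, e j ≠ 0 ∧ v = ((‖e j‖⁻¹ : ℝ) : ℂ) • e j := fun v hv ↦ by
    simp only [E₁, Finset.mem_image, Finset.mem_filter, Finset.mem_range] at hv
    obtain ⟨j, ⟨hj, hje⟩, rfl⟩ := hv
    exact ⟨j, hj, hje, rfl⟩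
  have hKv : ∀ v ∈ E, (T + K) v = T v := fun v hv ↦ by
    rw [add_apply, hK0 v hv, add_zero]
  refine ⟨K, ?_, ?_, hK0, E ∪ E₁, Finset.subset_union_left, ⟨?_, ?_, ?_⟩, P ξ +
    ∑ j ∈ Finset.range M, e j, ?_, ?_⟩
  · have h1 : Commute Q P := hPT.cfc_real q
    exact ((hQs.sub hT).commute_iff ((IsSelfAdjoint.one _).sub hP)).1
      (((Commute.one_right _).sub_right (h1.sub_left hPT)))
  · refine (norm_mul_le _ _).trans ?_
    have h1 : ‖1 - P‖ ≤ 1 := by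
      rw [show (1 - P : H →L[ℂ] H) = Vᗮ.starProjection from
        (Submodule.starProjection_orthogonal V).symm]
      exact Vᗮ.starProjection_norm_le
    exact (mul_le_of_le_one_right (norm_nonneg _) h1).trans hQT
  · intro v hv
    rcases Finset.mem_union.1 hv with hv | hv
    · exact hE.norm_eq_one v hv
    · obtain ⟨j, -, hje, rfl⟩ := hE₁ v hv
      rw [Complex.ofReal_inv]
      exact norm_smul_inv_norm hje
  · intro v hv
    rcases Finset.mem_union.1 hv with hv | hv
    · exact ⟨s v, hsS v hv, by rw [hKv v hv, hs v hv]⟩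
    · obtain ⟨j, hj, -, rfl⟩ := hE₁ v hv
      exact ⟨c (j + 1), (hcS _).1, by rw [map_smul, hKe j hj, smul_comm]⟩
  · have hu : ∀ {v : H} {x y : ℝ}, v ≠ 0 → (T + K) v = (x : ℂ) • v → (T + K) v = (y : ℂ) • v →
        x = y := fun hv hx hy ↦
      Complex.ofReal_injective (smul_left_injective ℂ hv (hx.symm.trans hy))
    have hne : ∀ v ∈ E, v ≠ 0 := fun v hv ↦ by
      rw [← norm_ne_zero_iff, hE.norm_eq_one v hv]
      exact one_ne_zero
    have hmix : ∀ v ∈ E, ∀ j < M, e j ≠ 0 → ∀ x : ℝ, (T + K) v = (x : ℂ) • v →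
        (T + K) (((‖e j‖⁻¹ : ℝ) : ℂ) • e j) = (x : ℂ) • ((‖e j‖⁻¹ : ℝ) : ℂ) • e j → False := by
      intro v hv j hj hje x hx hx'
      have h1 : s v = x := hu (hne v hv) (by rw [hKv v hv, hs v hv]) hx
      have h2 : c (j + 1) = x := hu (by simpa using hje) (by rw [map_smul, hKe j hj, smul_comm]) hx'
      refine (hcS (j + 1)).2 ?_
      rw [h2, ← h1]
      exact Finset.mem_coe.2 (Finset.mem_image_of_mem s hv)
    intro v hv v' hv' x hx hx'
    rcases Finset.mem_union.1 hv with hv | hv <;> rcases Finset.mem_union.1 hv' with hv' | hv'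
    · rw [hKv v hv] at hx
      rw [hKv v' hv'] at hx'
      exact hE.eq_of_eigenvalue v hv v' hv' x hx hx'
    · obtain ⟨j, hj, hje, rfl⟩ := hE₁ v' hv'
      exact (hmix v hv j hj hje x hx hx').elim
    · obtain ⟨j, hj, hje, rfl⟩ := hE₁ v hv
      exact (hmix v' hv' j hj hje x hx' hx).elim
    · obtain ⟨j, hj, hje, rfl⟩ := hE₁ v hv
      obtain ⟨i, hi, hie, rfl⟩ := hE₁ v' hv'
      have h1 : c (j + 1) = x := hu (by simpa using hje) (by rw [map_smul, hKe j hj, smul_comm]) hx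
      have h2 : c (i + 1) = x := hu (by simpa using hie) (by rw [map_smul, hKe i hi, smul_comm]) hx'
      have h3 : j = i := by simpa using hcinj.injective (h1.trans h2.symm)
      rw [h3]
  · refine Submodule.add_mem _ (Submodule.span_mono ?_ (V.starProjection_apply_mem ξ))
      (Submodule.sum_mem _ fun j hj ↦ ?_)
    · exact Finset.coe_subset.2 Finset.subset_union_left
    · by_cases hje : e j = 0
      · rw [hje]
        exact Submodule.zero_mem _
      · have h1 : e j = (‖e j‖ : ℂ) • ((‖e j‖⁻¹ : ℝ) : ℂ) • e j := by
          rw [smul_smul, ← Complex.ofReal_mul, mul_inv_cancel₀ (norm_ne_zero_iff.2 hje),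
            Complex.ofReal_one, one_smul]
        rw [h1]
        refine Submodule.smul_mem _ _ (Submodule.subset_span ?_)
        exact Finset.mem_union_right _ (Finset.mem_image_of_mem _ (Finset.mem_filter.2 ⟨hj, hje⟩))
  · have h1 : ∑ j ∈ Finset.range M, cfc (f j) T + ∑ j ∈ Finset.range M, cfc (g j) T = 1 := by
      rw [← cfc_sum f T _ fun j _ ↦ (hfc j).continuousOn,
        ← cfc_sum g T _ fun j _ ↦ (hgc j).continuousOn,
        ← cfc_add T (∑ j ∈ Finset.range M, f j) (∑ j ∈ Finset.range M, g j)
          (by simpa only [Finset.sum_fn] using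
            (continuous_finsetSum _ fun j _ ↦ hfc j).continuousOn)
          (by simpa only [Finset.sum_fn] using
            (continuous_finsetSum _ fun j _ ↦ hgc j).continuousOn), ← cfc_one ℝ T]
      refine cfc_congr fun x hx ↦ ?_
      have h2 := abs_le.1 (hspec x hx)
      simp only [Finset.sum_apply, Pi.one_apply]
      refine hfg x ?_ (h2.2.trans hM)
      simp only [t]
      push_cast
      linarith
    have h2 := DFunLike.congr_fun h1 (ξ - P ξ)
    rw [add_apply, _root_.sum_apply, _root_.sum_apply, one_apply_eq_self] at h2
    have h3 : ξ - (P ξ + ∑ j ∈ Finset.range M, e j) =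
        ∑ j ∈ Finset.range M, cfc (g j) T (ξ - P ξ) := by
      rw [← sub_sub, sub_eq_iff_eq_add', h2]
    rw [h3]
    refine (norm_sum_le_of_le _ fun j _ ↦ hg j (g j) (hgc j) (hg1 j) (hg0 j)).trans ?_
    rw [Finset.sum_const, Finset.card_range, nsmul_eq_mul, mul_div_assoc',
      div_le_iff₀ (by positivity)]
    linarith

end EigenSystem

section Conclusion

section Single
variable {H : Type*} [NormedAddCommGroup H] [InnerProductSpace ℂ H] [CompleteSpace H]
  {S : Set ℝ} {T : H →L[ℂ] H} {E : Set H}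

theorem IsSimpleEigenSystem.exists_hilbertBasis (h : IsSimpleEigenSystem S T E)
    (hT : IsSelfAdjoint T) (hEc : E.Countable)
    (hE : ⊤ ≤ (Submodule.span ℂ E).topologicalClosure) :
    ∃ (ι : Type) (b : HilbertBasis ι ℂ H), ∀ i, b i ∈ E := by
  have := hEc.to_subtype
  obtain ⟨f, hf⟩ := exists_injective_nat E
  let e : Set.range f ≃ E := (Equiv.ofInjective f hf).symm
  have ho : Orthonormal ℂ fun i ↦ (e i : H) := (h.orthonormal hT).comp e e.injective
  have hr : Set.range (fun i ↦ (e i : H)) = E := by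
    rw [show (fun i ↦ (e i : H)) = Subtype.val ∘ e from rfl, e.surjective.range_comp,
      Subtype.range_coe]
  exact ⟨Set.range f, HilbertBasis.mk ho (hr.symm ▸ hE), fun i ↦ by
    rw [HilbertBasis.coe_mk]; exact (e i).2⟩

/-- Every eigenvector of `T` is a multiple of a member of a complete system of eigenvectors with
distinct eigenvalues. -/
theorem IsSimpleEigenSystem.exists_eigenspace_eq_span (h : IsSimpleEigenSystem S T E)
    (hT : IsSelfAdjoint T) {ι : Type*} (b : HilbertBasis ι ℂ H) (hb : ∀ i, b i ∈ E) {μ : ℂ}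
    {x : H} (hx0 : x ≠ 0) (hx : T x = μ • x) :
    ∃ s ∈ S, μ = (s : ℂ) ∧ ∃ i, ∀ y, T y = μ • y → y ∈ Submodule.span ℂ {b i} := by
  choose s hsS hs using fun i ↦ h.exists_eigenvalue (b i) (hb i)
  have key : ∀ y, T y = μ • y → ∀ i, inner ℂ (b i) y ≠ (0 : ℂ) → μ = s i := fun y hy i hi ↦ by
    have h1 : inner ℂ (T (b i)) y = inner ℂ (b i) (T y) := hT.isSymmetric (b i) y
    rw [hs i, hy, inner_smul_left, inner_smul_right, Complex.conj_ofReal] at h1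
    exact (mul_right_cancel₀ hi h1).symm
  obtain ⟨i, hi⟩ : ∃ i, inner ℂ (b i) x ≠ (0 : ℂ) := by
    by_contra! hcon
    refine hx0 (b.repr.map_eq_zero_iff.1 ?_)
    ext i
    rw [b.repr_apply_apply, hcon]
    rfl
  have hμ := key x hx i hi
  refine ⟨s i, hsS i, hμ, i, fun y hy ↦ ?_⟩
  rw [← (b.hasSum_repr y).tsum_eq, tsum_eq_single i]
  · exact Submodule.smul_mem _ _ (Submodule.mem_span_singleton_self _)
  · intro j hji
    rw [b.repr_apply_apply]
    by_contra hne
    have hj := key y hy j fun h0 ↦ hne (by rw [h0, zero_smul])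
    refine hji (b.orthonormal.linearIndependent.injective ?_)
    exact h.eq_of_eigenvalue _ (hb j) _ (hb i) (s i) (by rw [hs j, ← hj, hμ]) (hs i)

theorem IsSimpleEigenSystem.diagonal_simple (h : IsSimpleEigenSystem S T E)
    (hT : IsSelfAdjoint T) (hEc : E.Countable)
    (hE : ⊤ ≤ (Submodule.span ℂ E).topologicalClosure) :
    (∃ (ι : Type) (b : HilbertBasis ι ℂ H), ∀ i, ∃ μ ∈ S, T (b i) = (μ : ℂ) • b i) ∧
      (∀ μ : ℂ, Module.End.eigenspace (T : H →ₗ[ℂ] H) μ ≠ ⊥ → ∃ s ∈ S, μ = (s : ℂ)) ∧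
      ∀ μ : ℂ, Module.rank ℂ (Module.End.eigenspace (T : H →ₗ[ℂ] H) μ) ≤ 1 := by
  obtain ⟨ι, b, hb⟩ := h.exists_hilbertBasis hT hEc hE
  have key : ∀ μ : ℂ, Module.End.eigenspace (T : H →ₗ[ℂ] H) μ ≠ ⊥ → ∃ s ∈ S, μ = (s : ℂ) ∧
      ∃ i, ∀ y, T y = μ • y → y ∈ Submodule.span ℂ {b i} := fun μ hμ ↦ by
    obtain ⟨x, hx, hx0⟩ := Submodule.exists_mem_ne_zero_of_ne_bot hμ
    exact h.exists_eigenspace_eq_span hT b hb hx0 (Module.End.mem_eigenspace_iff.1 hx)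
  refine ⟨⟨ι, b, fun i ↦ h.exists_eigenvalue _ (hb i)⟩, fun μ hμ ↦ ?_, fun μ ↦ ?_⟩
  · obtain ⟨s, hs, hsμ, -⟩ := key μ hμ
    exact ⟨s, hs, hsμ⟩
  · by_cases hμ : Module.End.eigenspace (T : H →ₗ[ℂ] H) μ = ⊥
    · rw [hμ, rank_bot]
      exact zero_le_one
    · obtain ⟨-, -, -, i, hi⟩ := key μ hμ
      refine (Submodule.rank_mono fun y hy ↦ hi y (Module.End.mem_eigenspace_iff.1 hy)).trans ?_
      exact (rank_span_le _).trans_eq (Cardinal.mk_singleton _)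

variable {A : Type*} [NonUnitalCStarAlgebra A]

theorem separableSpace_of_irreducible [TopologicalSpace.SeparableSpace A]
    (π : A →⋆ₙₐ[ℂ] (H →L[ℂ] H))
    (hnondeg : Dense (↑(Submodule.span ℂ
      (Set.range fun p : A × H ↦ π p.1 p.2)) : Set H))
    (hirr : ∀ V : Submodule ℂ H, IsClosed (V : Set H) →
      (∀ a : A, ∀ ξ ∈ V, π a ξ ∈ V) → V = ⊥ ∨ V = ⊤) :
    TopologicalSpace.SeparableSpace H := by
  rcases subsingleton_or_nontrivial H with hH | hH
  · infer_instance
  obtain ⟨ξ, hξ⟩ := exists_ne (0 : H)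
  have hπ : Continuous π := AddMonoidHomClass.continuous_of_bound π 1
    (by simpa using NonUnitalStarAlgHom.norm_apply_le π)
  let φ : A →ₗ[ℂ] H :=
    { toFun a := π a ξ
      map_add' a c := by simp
      map_smul' r a := by simp }
  have hφ : Continuous φ := hπ.clm_apply continuous_const
  have hV : ∀ a, ∀ x ∈ (LinearMap.range φ).topologicalClosure,
      π a x ∈ (LinearMap.range φ).topologicalClosure := by
    intro a
    have h1 : LinearMap.range φ ≤
        (LinearMap.range φ).topologicalClosure.comap (π a).toLinearMap := by
      rintro _ ⟨c, rfl⟩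
      refine (LinearMap.range φ).le_topologicalClosure ⟨a * c, ?_⟩
      simp [φ]
    exact fun x hx ↦ (LinearMap.range φ).topologicalClosure_minimal h1
      ((LinearMap.range φ).isClosed_topologicalClosure.preimage (π a).continuous) hx
  have htop := (hirr _ (LinearMap.range φ).isClosed_topologicalClosure hV).resolve_left fun h ↦ by
    refine hξ (eq_zero_of_forall_apply_eq_zero π hnondeg fun a ↦ ?_)
    rw [← Submodule.mem_bot ℂ, ← h]
    exact (LinearMap.range φ).le_topologicalClosure ⟨a, rfl⟩
  have hd : DenseRange φ := by
    have := Submodule.dense_iff_topologicalClosure_eq_top.2 htop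
    rwa [LinearMap.coe_range] at this
  exact hd.separableSpace hφ

end Single

variable {A κ : Type*} [NonUnitalCStarAlgebra A] {H : κ → Type*} [∀ n, NormedAddCommGroup (H n)]
  [∀ n, InnerProductSpace ℂ (H n)] [∀ n, CompleteSpace (H n)]

open Classical in
theorem exists_enlarged_eigenSystem (π : ∀ n, A →⋆ₙₐ[ℂ] (H n →L[ℂ] H n))
    (hnondeg : ∀ n, Dense (↑(Submodule.span ℂ
      (Set.range fun p : A × H n ↦ π n p.1 p.2)) : Set (H n)))
    (hirr : ∀ n, ∀ V : Submodule ℂ (H n), IsClosed (V : Set (H n)) →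
      (∀ a : A, ∀ ξ ∈ V, π n a ξ ∈ V) → V = ⊥ ∨ V = ⊤)
    (hdisj : ∀ m n, m ≠ n → ∀ T : H m →L[ℂ] H n,
      (∀ a : A, (T.comp (π m a) : H m →L[ℂ] H n) = (π n a).comp T) → T = 0)
    {S : κ → Set ℝ} (hS : ∀ n, Dense (S n)) {h : A} (hh : IsSelfAdjoint h)
    {E : ∀ n, Finset (H n)} (hE : ∀ n, IsSimpleEigenSystem (S n) (π n h) (E n : Set (H n)))
    {I : Finset κ} (hEI : ∀ n ∉ I, E n = ∅) (n : κ) (ξ : H n) {ε : ℝ} (hε : 0 < ε) :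
    ∃ h' : A, IsSelfAdjoint h' ∧ ‖h' - h‖ ≤ ε ∧ ∃ E' : ∀ n, Finset (H n),
      (∀ n, IsSimpleEigenSystem (S n) (π n h') (E' n : Set (H n))) ∧
      (∃ I' : Finset κ, ∀ n ∉ I', E' n = ∅) ∧ (∀ n, E n ⊆ E' n) ∧
      (∀ n, ∀ v ∈ E n, π n h' v = π n h v) ∧
      ∃ w ∈ Submodule.span ℂ (E' n : Set (H n)), ‖ξ - w‖ ≤ ε := by
  obtain ⟨K₀, hK₀, hK₀ε, hK₀E, E₀, hEE₀, hE₀, w, hw, hwε⟩ :=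
    (hE n).exists_perturbation (hS n) (hh.map (π n)) ξ (half_pos hε)
  let K : ∀ m, H m →L[ℂ] H m := Function.update 0 n K₀
  let E' : ∀ m, Finset (H m) := Function.update E n E₀
  have hKn : K n = K₀ := Function.update_self ..
  have hE'n : E' n = E₀ := Function.update_self ..
  have hKm : ∀ m, m ≠ n → K m = 0 := fun m hm ↦ Function.update_of_ne hm ..
  have hE'm : ∀ m, m ≠ n → E' m = E m := fun m hm ↦ Function.update_of_ne hm ..
  have hK : ∀ m, IsSelfAdjoint (K m) ∧ ‖K m‖ ≤ ε / 2 ∧ (∀ v ∈ E m, K m v = 0) ∧ E m ⊆ E' m ∧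
      IsSimpleEigenSystem (S m) (π m h + K m) (E' m : Set (H m)) := fun m ↦ by
    rcases eq_or_ne m n with rfl | hm
    · rw [hKn, hE'n]
      exact ⟨hK₀, hK₀ε, hK₀E, hEE₀, hE₀⟩
    · rw [hKm m hm, hE'm m hm, add_zero]
      exact ⟨.zero _, by rw [norm_zero]; exact (half_pos hε).le, fun _ _ ↦ rfl, subset_rfl, hE m⟩
  have hI' : ∀ m ∉ insert n I, E' m = ∅ := fun m hm ↦ by
    rw [Finset.mem_insert, not_or] at hm
    rw [hE'm m hm.1, hEI m hm.2]
  obtain ⟨a, ha, haε, haK⟩ := exists_isSelfAdjoint_eqOn_orthonormal π hnondeg hirr hdisj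
    (fun m ↦ (hK m).2.2.2.2.orthonormal ((hh.map (π m)).add (hK m).1)) hI'
    (fun m ↦ (hK m).1) (half_pos hε) fun m ↦ (hK m).2.1
  have hπ : ∀ m, ∀ v ∈ E' m, π m (h + a) v = (π m h + K m) v := fun m v hv ↦ by
    rw [map_add, add_apply, add_apply, haK m v hv]
  refine ⟨h + a, hh.add ha, ?_, E', fun m ↦ (hK m).2.2.2.2.congr (hπ m), ⟨_, hI'⟩,
    fun m ↦ (hK m).2.2.2.1, fun m v hv ↦ ?_, w, ?_, hwε.trans (half_le_self hε.le)⟩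
  · rw [add_sub_cancel_left]
    linarith
  · rw [hπ m v ((hK m).2.2.2.1 hv), add_apply, (hK m).2.2.1 v hv, add_zero]
  · rwa [hE'n]

end Conclusion

section Limit

theorem exists_diagonal_simple_eigenvalues {A : Type*} [NonUnitalCStarAlgebra A]
    [TopologicalSpace.SeparableSpace A] {H : ℕ → Type*} [∀ n, NormedAddCommGroup (H n)]
    [∀ n, InnerProductSpace ℂ (H n)] [∀ n, CompleteSpace (H n)]
    (π : ∀ n, A →⋆ₙₐ[ℂ] (H n →L[ℂ] H n))
    (hnondeg : ∀ n, Dense (↑(Submodule.span ℂ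
      (Set.range fun p : A × H n ↦ π n p.1 p.2)) : Set (H n)))
    (hirr : ∀ n, ∀ V : Submodule ℂ (H n), IsClosed (V : Set (H n)) →
      (∀ a : A, ∀ ξ ∈ V, π n a ξ ∈ V) → V = ⊥ ∨ V = ⊤)
    (hdisj : ∀ m n, m ≠ n → ∀ T : H m →L[ℂ] H n,
      (∀ a : A, (T.comp (π m a) : H m →L[ℂ] H n) = (π n a).comp T) → T = 0)
    {S : ℕ → Set ℝ} (hS : ∀ n, Dense (S n)) :
    ∃ h : A, IsSelfAdjoint h ∧ ∀ n, ∃ E : Set (H n), E.Countable ∧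
      IsSimpleEigenSystem (S n) (π n h) E ∧ ⊤ ≤ (Submodule.span ℂ E).topologicalClosure := by
  have hsep n := separableSpace_of_irreducible (π n) (hnondeg n) (hirr n)
  let X : Type _ := {p : A × (∀ n, Finset (H n)) // IsSelfAdjoint p.1 ∧
    (∀ n, IsSimpleEigenSystem (S n) (π n p.1) (p.2 n : Set (H n))) ∧
      ∃ I : Finset ℕ, ∀ n ∉ I, p.2 n = ∅}
  let idx (k : ℕ) : ℕ := (Nat.unpair k).1
  let target (k : ℕ) : H (idx k) :=
    TopologicalSpace.denseSeq (H (idx k)) (Nat.unpair (Nat.unpair k).2).1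
  have step : ∀ (k : ℕ) (p : X), ∃ p' : X, ‖p'.1.1 - p.1.1‖ ≤ 1 / 2 ^ k ∧
      (∀ n, p.1.2 n ⊆ p'.1.2 n) ∧ (∀ n, ∀ v ∈ p.1.2 n, π n p'.1.1 v = π n p.1.1 v) ∧
      ∃ w ∈ Submodule.span ℂ (p'.1.2 (idx k) : Set (H (idx k))),
        ‖target k - w‖ ≤ 1 / 2 ^ k := by
    rintro k ⟨⟨h, E⟩, hh, hE, I, hI⟩
    obtain ⟨h', hh', hε, E', hE', hI', hEE', heq, hw⟩ := exists_enlarged_eigenSystem π hnondeg hirr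
      hdisj hS hh hE hI (idx k) (target k) (ε := 1 / 2 ^ k) (by positivity)
    exact ⟨⟨⟨h', E'⟩, hh', hE', hI'⟩, hε, hEE', heq, hw⟩
  choose next hnext using step
  let p : ℕ → X := fun k ↦ Nat.rec ⟨⟨0, fun _ ↦ ∅⟩, .zero A, fun n ↦ by
    simpa using IsSimpleEigenSystem.empty _ _, ∅, fun _ _ ↦ rfl⟩ next k
  have hp : ∀ k, p (k + 1) = next k (p k) := fun k ↦ rfl
  have hcau : CauchySeq fun k ↦ (p k).1.1 := by
    refine cauchySeq_of_le_geometric_two (C := 2) fun k ↦ ?_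
    rw [dist_comm, dist_eq_norm, hp]
    exact (hnext k (p k)).1.trans_eq (by norm_num)
  obtain ⟨h, hlim⟩ := cauchySeq_tendsto_of_complete hcau
  refine ⟨h, ?_, fun n ↦ ?_⟩
  · exact tendsto_nhds_unique (hlim.star.congr fun k ↦ (p k).2.1) hlim
  have hmono : Monotone fun k ↦ ((p k).1.2 n : Set (H n)) :=
    monotone_nat_of_le_succ fun k ↦ Finset.coe_subset.2 ((hnext k (p k)).2.1 n)
  have hconst : ∀ k m, k ≤ m → ∀ v ∈ (p k).1.2 n, π n (p m).1.1 v = π n (p k).1.1 v := by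
    intro k m hkm v hv
    induction m, hkm using Nat.le_induction with
    | base => rfl
    | succ m hkm ih =>
      rw [← ih, hp]
      exact (hnext m (p m)).2.2.1 n v (hmono hkm hv)
  have hπ : Continuous (π n) := AddMonoidHomClass.continuous_of_bound (π n) 1
    (by simpa using NonUnitalStarAlgHom.norm_apply_le (π n))
  have heq : ∀ k, ∀ v ∈ (p k).1.2 n, π n h v = π n (p k).1.1 v := fun k v hv ↦ by
    have h1 : Tendsto (fun m ↦ π n (p m).1.1 v) atTop (𝓝 (π n h v)) :=
      ((hπ.clm_apply continuous_const).tendsto h).comp hlim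
    refine tendsto_nhds_unique h1 (tendsto_const_nhds.congr' ?_)
    filter_upwards [eventually_ge_atTop k] with m hm
    exact (hconst k m hm v hv).symm
  refine ⟨⋃ k, ((p k).1.2 n : Set (H n)), Set.countable_iUnion fun k ↦ Finset.countable_toSet _,
    .iUnion_of_monotone hmono fun k ↦ ((p k).2.2.1 n).congr (heq k), ?_⟩
  rw [top_le_iff, ← Submodule.dense_iff_topologicalClosure_eq_top]
  refine (TopologicalSpace.denseRange_denseSeq (H n)).mono ?_ |>.of_closure
  rintro _ ⟨i, rfl⟩
  refine Metric.mem_closure_iff.2 fun ε hε ↦ ?_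
  obtain ⟨j, hj⟩ := exists_pow_lt_of_lt_one hε (by norm_num : (1 / 2 : ℝ) < 1)
  obtain ⟨w, hw, hwε⟩ : ∃ w ∈ Submodule.span ℂ (⋃ k, ((p k).1.2 n : Set (H n))),
      ‖TopologicalSpace.denseSeq (H n) i - w‖ ≤ 1 / 2 ^ Nat.pair n (Nat.pair i j) := by
    have key : ∀ k n, idx k = n → ∃ w ∈ Submodule.span ℂ (⋃ k, ((p k).1.2 n : Set (H n))),
        ‖TopologicalSpace.denseSeq (H n) (Nat.unpair (Nat.unpair k).2).1 - w‖ ≤ 1 / 2 ^ k := by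
      rintro k _ rfl
      obtain ⟨w, hw, hwε⟩ := (hnext k (p k)).2.2.2
      exact ⟨w, Submodule.span_mono (Set.subset_iUnion
        (fun k' ↦ ((p k').1.2 (idx k) : Set (H (idx k)))) (k + 1)) hw, hwε⟩
    simpa only [Nat.unpair_pair] using
      key (Nat.pair n (Nat.pair i j)) n (by simp only [idx, Nat.unpair_pair])
  refine ⟨w, hw, ?_⟩
  rw [dist_eq_norm]
  refine hwε.trans_lt (lt_of_le_of_lt ?_ hj)
  rw [one_div_pow]
  exact one_div_pow_le_one_div_pow_of_le one_le_two
    ((Nat.right_le_pair i j).trans (Nat.right_le_pair n _))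

end Limit

/-- Given a sequence of mutually disjoint irreducible representations
`π n` of a separable C*-algebra `A` and dense subsets `S n ⊆ ℝ`, there is a
self-adjoint `h ∈ A` such that each `π n h` is diagonal with simple eigenvalues
lying in `S n`. -/
theorem exists_selfAdjoint_diagonal_simple_eigenvalues
    {A : Type*} [NonUnitalNormedRing A] [StarRing A] [CStarRing A]
    [NormedSpace ℂ A] [IsScalarTower ℂ A A] [SMulCommClass ℂ A A]
    [CompleteSpace A] [StarModule ℂ A] [TopologicalSpace.SeparableSpace A]
    (H : ℕ → Type*) [∀ n, NormedAddCommGroup (H n)] [∀ n, InnerProductSpace ℂ (H n)]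
    [∀ n, CompleteSpace (H n)]
    (π : ∀ n, A →⋆ₙₐ[ℂ] (H n →L[ℂ] H n))
    -- each `π n` is nondegenerate
    (hnondeg : ∀ n, Dense (↑(Submodule.span ℂ
      (Set.range fun p : A × H n => π n p.1 p.2)) : Set (H n)))
    -- each `π n` is irreducible
    (hirr : ∀ n, ∀ V : Submodule ℂ (H n), IsClosed (V : Set (H n)) →
      (∀ a : A, ∀ ξ ∈ V, π n a ξ ∈ V) → V = ⊥ ∨ V = ⊤)
    -- the representations are mutually disjoint
    (hdisj : ∀ m n, m ≠ n → ∀ T : H m →L[ℂ] H n,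
      (∀ a : A, (T.comp (π m a) : H m →L[ℂ] H n) = (π n a).comp T) → T = 0)
    -- dense subsets of ℝ
    (S : ℕ → Set ℝ) (hS : ∀ n, Dense (S n)) :
    ∃ h : A, IsSelfAdjoint h ∧ ∀ n : ℕ,
      -- `H n` has an orthonormal (Hilbert) basis of eigenvectors of `π n h`
      -- with eigenvalues in `S n`
      (∃ (ι : Type) (b : HilbertBasis ι ℂ (H n)), ∀ i : ι,
        ∃ μ ∈ S n, π n h (b i) = (μ : ℂ) • b i) ∧
      -- every eigenvalue of `π n h` lies in `S n` (as a real number)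
      (∀ μ : ℂ, Module.End.eigenspace
          ((π n h : H n →L[ℂ] H n) : H n →ₗ[ℂ] H n) μ ≠ ⊥ →
        ∃ s ∈ S n, μ = (s : ℂ)) ∧
      -- every eigenvalue of `π n h` has multiplicity one
      (∀ μ : ℂ, Module.rank ℂ (Module.End.eigenspace
          ((π n h : H n →L[ℂ] H n) : H n →ₗ[ℂ] H n) μ) ≤ 1) := by
  let _ : NonUnitalCStarAlgebra A := {}
  obtain ⟨h, hh, hE⟩ := exists_diagonal_simple_eigenvalues π hnondeg hirr hdisj hS
  refine ⟨h, hh, fun n ↦ ?_⟩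
  obtain ⟨E, hEc, hE, hEd⟩ := hE n
  exact hE.diagonal_simple (hh.map (π n)) hEc hEd
end

section
/- Let A be a unital C*-algebra, let α be a flow on A, and let σ be a *-automorphism of A such that σ ∘ α_t = α_t ∘ σ for all t ∈ ℝ. Then the following are equivalent: (1) there is a sequence (u_n) of unitaries of A with each u_n in the domain D(δ_α) of the generator of α, such that ‖u_n x u_n* − σ(x)‖ → 0 for every x ∈ A and sup_n ‖δ_α(u_n)‖ < ∞; (2) there is a sequence (u_n) of unitaries of A such that ‖u_n x u_n* − σ(x)‖ → 0 for every x ∈ A and the family of maps t ↦ α_t(u_n), n ∈ ℕ, is equicontinuous, i.e., for every ε > 0 there is δ > 0 such that ‖α_s(u_n) − α_t(u_n)‖ < ε for all n whenever |s − t| < δ. -/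
open Filter Topology

/-- `HasGenDeriv α x y` : `x` is in the domain of the generator `δ_α` of the flow
`α` and `δ_α(x) = y`. -/
def HasGenDeriv {A : Type*} [NormedRing A] [StarRing A] [CStarRing A]
    [NormedAlgebra ℂ A] [CompleteSpace A] [StarModule ℂ A]
    (α : ℝ → A ≃⋆ₐ[ℂ] A) (x y : A) : Prop :=
  Tendsto (fun t : ℝ => t⁻¹ • (α t x - x)) (𝓝[≠] (0 : ℝ)) (𝓝 y)

section CStarAlgebra

variable {A : Type*} [CStarAlgebra A]

lemma norm_le_one_of_mem_unitary {u : A} (hu : u ∈ unitary A) : ‖u‖ ≤ 1 := by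
  nontriviality A
  exact (CStarRing.norm_of_mem_unitary hu).le

lemma norm_le_two_mul_norm_mul {b : A} (hb : ‖b - 1‖ ≤ 1 / 2) (y : A) :
    ‖y‖ ≤ 2 * ‖y * b‖ := by
  have h : y = y * b - y * (b - 1) := by noncomm_ring
  have h1 : ‖y‖ ≤ ‖y * b‖ + ‖y * (b - 1)‖ := by
    conv_lhs => rw [h]
    exact norm_sub_le _ _
  have h2 : ‖y * (b - 1)‖ ≤ ‖y‖ * (1 / 2) :=
    (norm_mul_le _ _).trans (by gcongr)
  linarith

lemma norm_le_norm_mul_add_mul {b : A} (hb : ‖b - 1‖ ≤ 1 / 2) (y : A) :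
    ‖y‖ ≤ ‖b * y + y * b‖ := by
  have h : y + y = (b * y + y * b) - ((b - 1) * y + y * (b - 1)) := by noncomm_ring
  have h0 : ‖y + y‖ = 2 * ‖y‖ := by rw [← two_smul ℝ y, norm_smul]; simp
  have h1 : ‖y + y‖ ≤ ‖b * y + y * b‖ + (‖(b - 1) * y‖ + ‖y * (b - 1)‖) := by
    rw [h]
    exact (norm_sub_le _ _).trans (by gcongr; exact norm_add_le _ _)
  have h2 : ‖y * (b - 1)‖ ≤ ‖y‖ * (1 / 2) :=
    (norm_mul_le _ _).trans (by gcongr)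
  have h3 : ‖(b - 1) * y‖ ≤ (1 / 2) * ‖y‖ :=
    (norm_mul_le _ _).trans (by gcongr)
  linarith

lemma norm_commutator_le_norm_commutator_sq {b : A} (hb : ‖b - 1‖ ≤ 1 / 2) (x : A) :
    ‖b * x - x * b‖ ≤ ‖b * b * x - x * (b * b)‖ := by
  convert norm_le_norm_mul_add_mul hb (b * x - x * b) using 2
  noncomm_ring

/-- The operator of left plus right multiplication by an element near `1` is invertible. -/
lemma exists_equiv_mul_add_mul {b : A} (hb : ‖b - 1‖ ≤ 1 / 2) :
    ∃ L : A ≃L[ℝ] A, ∀ y, L y = (2⁻¹ : ℝ) • (b * y + y * b) := by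
  let T : A →L[ℝ] A :=
    (-2⁻¹ : ℝ) • (ContinuousLinearMap.mul ℝ A (b - 1) + (ContinuousLinearMap.mul ℝ A).flip (b - 1))
  have hT : ‖T‖ ≤ 1 / 2 := by
    refine T.opNorm_le_bound (by norm_num) fun y => ?_
    have h2 : ‖y * (b - 1)‖ ≤ ‖y‖ * (1 / 2) :=
      (norm_mul_le _ _).trans (by gcongr)
    have h3 : ‖(b - 1) * y‖ ≤ (1 / 2) * ‖y‖ :=
      (norm_mul_le _ _).trans (by gcongr)
    have h4 := norm_add_le ((b - 1) * y) (y * (b - 1))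
    have h5 : ‖T y‖ = 2⁻¹ * ‖(b - 1) * y + y * (b - 1)‖ := by
      simp only [T, smul_apply, add_apply,
        ContinuousLinearMap.flip_apply, ContinuousLinearMap.mul_apply', norm_smul]
      norm_num
    rw [h5]
    linarith
  refine ⟨ContinuousLinearEquiv.unitsEquiv ℝ A (Units.oneSub T (by linarith)), fun y => ?_⟩
  have h : (b - 1) * y + y * (b - 1) = (b * y + y * b) - (2 : ℝ) • y := by
    rw [two_smul]; noncomm_ring
  change (1 - T) y = _
  have hTy : T y = (-2⁻¹ : ℝ) • ((b - 1) * y + y * (b - 1)) := rfl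
  have hy : (2⁻¹ : ℝ) • (2 : ℝ) • y = y := inv_smul_smul₀ two_ne_zero y
  rw [sub_apply, hTy, h, neg_smul, smul_sub, hy]
  simp

/-- A continuous square root near `1` of a differentiable curve is differentiable. -/
lemma exists_hasDerivAt_of_mul_self {β : ℝ → A} {t : ℝ} {s : A} (hβ : ContinuousAt β t)
    (hb : ‖β t - 1‖ ≤ 1 / 2) (hs : HasDerivAt (fun r => β r * β r) s t) :
    ∃ b', HasDerivAt β b' t ∧ ‖b'‖ ≤ ‖s‖ := by
  obtain ⟨L, hL⟩ := exists_equiv_mul_add_mul hb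
  have hf : HasStrictFDerivAt (fun x : A => (2⁻¹ : ℝ) • (x * x)) (L : A →L[ℝ] A) (β t) := by
    have := (((hasStrictFDerivAt_id (𝕜 := ℝ) (β t)).mul' (hasStrictFDerivAt_id (β t))).const_smul
      (2⁻¹ : ℝ))
    convert! this using 1
    ext y
    simp [hL]
  have hinv := hf.to_localInverse.hasFDerivAt.comp_hasDerivAt t (hs.const_smul (2⁻¹ : ℝ))
  have hd : HasDerivAt β (L.symm ((2⁻¹ : ℝ) • s)) t := by
    refine hinv.congr_of_eventuallyEq ?_
    filter_upwards [hβ.eventually hf.eventually_left_inverse] with r hr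
    exact hr.symm
  refine ⟨_, hd, ?_⟩
  have h := (hd.mul hd).unique hs
  rw [add_comm] at h
  refine le_trans ?_ (congrArg norm h).le
  exact norm_le_norm_mul_add_mul hb _

lemma exists_selfAdjoint_sqrt {a : A} (ha : IsSelfAdjoint a) (h : ‖a - 1‖ ≤ 1 / 2) :
    ∃ b : A, IsSelfAdjoint b ∧ b * b = a ∧ ‖b - 1‖ ≤ 1 / 2 := by
  rcases subsingleton_or_nontrivial A with _ | _
  · exact ⟨a, ha, Subsingleton.elim _ _, h⟩
  have hspec : ∀ x ∈ spectrum ℝ a, |x - 1| ≤ 1 / 2 := fun x hx => by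
    have hx' : x - 1 ∈ spectrum ℝ (a - 1) := by
      rw [spectrum.mem_iff] at hx ⊢
      simpa using hx
    exact (spectrum.norm_le_norm_of_mem hx').trans h
  refine ⟨cfc Real.sqrt a, cfc_predicate _ _, ?_, ?_⟩
  · rw [← cfc_mul Real.sqrt Real.sqrt a]
    conv_rhs => rw [← cfc_id ℝ a]
    refine cfc_congr fun x hx => ?_
    have := abs_le.1 (hspec x hx)
    exact Real.mul_self_sqrt (by linarith)
  · have : cfc Real.sqrt a - 1 = cfc (fun x => Real.sqrt x - 1) a := by
      rw [cfc_sub Real.sqrt (fun _ => 1) a, cfc_const_one ℝ a]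
    rw [this]
    refine norm_cfc_le (by norm_num) fun x hx => ?_
    have h1 := abs_le.1 (hspec x hx)
    have h2 := Real.sq_sqrt (show 0 ≤ x by linarith)
    have h3 := Real.sqrt_nonneg x
    refine le_trans ?_ (hspec x hx)
    rw [Real.norm_eq_abs]
    have h4 : x - 1 = (Real.sqrt x - 1) * (Real.sqrt x + 1) := by linarith
    rw [h4, abs_mul]
    refine le_mul_of_one_le_right (abs_nonneg _) ?_
    rw [abs_of_nonneg] <;> linarith

/-- Polar decomposition of an element close to a unitary. -/
lemma exists_unitary_mul_sqrt {u v : A} (hu : u ∈ unitary A) (hv : ‖v‖ ≤ 1)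
    (huv : ‖v - u‖ ≤ 1 / 4) :
    ∃ w b : A, w ∈ unitary A ∧ w * b = v ∧ b * b = star v * v ∧ ‖b - 1‖ ≤ 1 / 2 ∧ IsUnit b := by
  have hu1 := norm_le_one_of_mem_unitary hu
  have ha : ‖star v * v - 1‖ ≤ 1 / 2 := by
    have h : star v * v - 1 = star v * (v - u) + star (v - u) * u := by
      rw [← Unitary.star_mul_self_of_mem hu, star_sub]
      noncomm_ring
    have h1 : ‖star v * (v - u)‖ ≤ 1 * (1 / 4) :=
      (norm_mul_le _ _).trans (by rw [norm_star]; gcongr)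
    have h2 : ‖star (v - u) * u‖ ≤ (1 / 4) * 1 :=
      (norm_mul_le _ _).trans (by rw [norm_star]; gcongr)
    rw [h]
    have := norm_add_le (star v * (v - u)) (star (v - u) * u)
    linarith
  obtain ⟨b, hbsa, hbb, hb⟩ := exists_selfAdjoint_sqrt (IsSelfAdjoint.star_mul_self v) ha
  have hbu : IsUnit b := by
    have := (Units.oneSub (1 - b) (by rw [norm_sub_rev]; linarith)).isUnit
    simpa using this
  have hvu : IsUnit v := by
    have h1 : ‖star u * (u - v)‖ < 1 := by
      rw [CStarRing.norm_mem_unitary_mul _ (Unitary.star_mem hu), norm_sub_rev]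
      linarith
    have h2 := (Unitary.toUnits ⟨u, hu⟩).isUnit.mul (Units.oneSub _ h1).isUnit
    have h3 : u * (1 - star u * (u - v)) = v := by
      rw [mul_sub, ← mul_assoc, Unitary.mul_star_self_of_mem hu]
      noncomm_ring
    rw [Units.val_oneSub] at h2
    exact h3 ▸ h2
  obtain ⟨U, rfl⟩ := hbu
  have hwb : v * (↑U⁻¹ : A) * U = v := by simp [mul_assoc]
  refine ⟨v * ↑U⁻¹, U, ?_, hwb, hbb, hb, U.isUnit⟩
  have hstar : star (v * (↑U⁻¹ : A)) * (v * ↑U⁻¹) = 1 := by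
    have h1 : star (↑U⁻¹ : A) * U = 1 := by
      have : star ((U : A) * ↑U⁻¹) = 1 := by simp
      rwa [star_mul, hbsa.star_eq] at this
    calc star (v * (↑U⁻¹ : A)) * (v * ↑U⁻¹) = star (↑U⁻¹ : A) * (star v * v) * ↑U⁻¹ := by
          rw [star_mul]; noncomm_ring
      _ = (star (↑U⁻¹ : A) * U) * (U * ↑U⁻¹) := by rw [← hbb]; noncomm_ring
      _ = 1 := by rw [h1]; simp
  have hwu : IsUnit (v * (↑U⁻¹ : A)) := hvu.mul (Units.isUnit _)
  refine Unitary.mem_iff.2 ⟨hstar, ?_⟩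
  obtain ⟨W, hW⟩ := hwu
  rw [← hW] at hstar ⊢
  rw [show star (W : A) = ↑W⁻¹ from Units.mul_eq_one_iff_eq_inv.1 hstar]
  simp

/-- Intertwining defects of the unitary part are controlled by those of the element. -/
lemma norm_unitary_intertwiner_le {v w b : A} (hw : w ∈ unitary A) (hwb : w * b = v)
    (hbb : b * b = star v * v) (hb : ‖b - 1‖ ≤ 1 / 2) (hv : ‖v‖ ≤ 1) (x y : A) :
    ‖w * x * star w - y‖ ≤
      4 * ‖v * x - y * v‖ + 2 * ‖v * star x - star y * v‖ := by
  have h1 : ‖w * x * star w - y‖ = ‖w * x - y * w‖ := by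
    rw [← CStarRing.norm_mul_mem_unitary (w * x * star w - y) hw, sub_mul, mul_assoc _ (star w) w,
      Unitary.star_mul_self_of_mem hw, mul_one]
  have h2 := norm_le_two_mul_norm_mul hb (w * x - y * w)
  have h3 : (w * x - y * w) * b = (v * x - y * v) - w * (b * x - x * b) := by
    rw [← hwb]; noncomm_ring
  have h4 : ‖(w * x - y * w) * b‖ ≤ ‖v * x - y * v‖ + ‖b * x - x * b‖ := by
    rw [h3, ← CStarRing.norm_mem_unitary_mul (b * x - x * b) hw]
    exact norm_sub_le _ _
  have h5 := norm_commutator_le_norm_commutator_sq hb x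
  have h6 : b * b * x - x * (b * b) =
      star v * (v * x - y * v) - star (v * star x - star y * v) * v := by
    rw [hbb]
    simp only [star_sub, star_mul, star_star]
    noncomm_ring
  have h7 : ‖star v * (v * x - y * v)‖ ≤ 1 * ‖v * x - y * v‖ :=
    (norm_mul_le _ _).trans (by rw [norm_star]; gcongr)
  have h8 : ‖star (v * star x - star y * v) * v‖ ≤ ‖v * star x - star y * v‖ * 1 :=
    (norm_mul_le _ _).trans (by rw [norm_star]; gcongr)
  have h9 := norm_sub_le (star v * (v * x - y * v)) (star (v * star x - star y * v) * v)
  rw [← h6] at h9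
  linarith

/-- If `v` is in the domain of the generator of a flow, so is its unitary part. -/
lemma exists_hasDerivAt_unitary_part {α : ℝ → A ≃⋆ₐ[ℂ] A} (hα0 : ∀ x : A, α 0 x = x)
    (hαcont : ∀ x : A, Continuous fun t : ℝ => α t x) {v w b v' : A} (hw : w ∈ unitary A)
    (hwb : w * b = v) (hbb : b * b = star v * v) (hb : ‖b - 1‖ ≤ 1 / 2) (hbu : IsUnit b)
    (hv : ‖v‖ ≤ 1) (hv' : HasDerivAt (fun t => α t v) v' 0) :
    ∃ w', HasDerivAt (fun t => α t w) w' 0 ∧ ‖w'‖ ≤ 6 * ‖v'‖ := by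
  have hs : HasDerivAt (fun t => α t b * α t b) (star v' * v + star v * v') 0 := by
    have h := hv'.star.mul hv'
    simp only [hα0] at h
    refine h.congr_of_eventuallyEq (Eventually.of_forall fun t => ?_)
    simp [← map_mul, ← map_star, hbb]
  obtain ⟨b', hb', hb'n⟩ := exists_hasDerivAt_of_mul_self (β := fun t => α t b)
    (hαcont b).continuousAt (by simpa [hα0] using hb) hs
  have hsn : ‖star v' * v + star v * v'‖ ≤ 2 * ‖v'‖ := by
    have h1 : ‖star v' * v‖ ≤ ‖v'‖ * 1 := (norm_mul_le _ _).trans (by rw [norm_star]; gcongr)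
    have h2 : ‖star v * v'‖ ≤ 1 * ‖v'‖ := (norm_mul_le _ _).trans (by rw [norm_star]; gcongr)
    have := norm_add_le (star v' * v) (star v * v')
    linarith
  obtain ⟨U, rfl⟩ := hbu
  have hwv : w = v * ↑U⁻¹ := by rw [← hwb]; simp [mul_assoc]
  have hinv : DifferentiableAt ℝ (fun t => Ring.inverse (α t (U : A))) 0 := by
    have h0 : DifferentiableAt ℝ Ring.inverse (α 0 (U : A)) := by
      rw [hα0]
      exact (hasFDerivAt_ringInverse U).differentiableAt
    exact h0.comp (0 : ℝ) hb'.differentiableAt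
  have hwd : DifferentiableAt ℝ (fun t => α t w) 0 := by
    refine (hv'.differentiableAt.mul hinv).congr_of_eventuallyEq
      (Eventually.of_forall fun t => ?_)
    have h1 : α t (U : A) = (Units.map (α t : A →* A) U : Aˣ) := rfl
    simp only [Pi.mul_apply, h1, Ring.inverse_unit]
    rw [hwv, map_mul]
    rfl
  refine ⟨_, hwd.hasDerivAt, ?_⟩
  set w' := deriv (fun t => α t w) 0
  have hmul := hwd.hasDerivAt.mul hb'
  have heq : w' * U + w * b' = v' := by
    have h2 : HasDerivAt (fun t => α t v) (w' * U + w * b') 0 := by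
      simp only [hα0] at hmul
      refine hmul.congr_of_eventuallyEq (Eventually.of_forall fun t => ?_)
      simp [← map_mul, hwb]
    exact h2.unique hv'
  have h3 := norm_le_two_mul_norm_mul hb w'
  have h4 : ‖w' * U‖ ≤ ‖v'‖ + ‖b'‖ := by
    rw [eq_sub_of_add_eq heq, ← CStarRing.norm_mem_unitary_mul b' hw]
    exact norm_sub_le _ _
  linarith

/-- The average of an orbit of a flow over `[0, h]`. -/
noncomputable def flowAverage (α : ℝ → A ≃⋆ₐ[ℂ] A) (h : ℝ) (u : A) : A :=
  h⁻¹ • ∫ s in (0 : ℝ)..h, α s u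

section Flow

variable {α : ℝ → A ≃⋆ₐ[ℂ] A} {h : ℝ}

lemma norm_flowAverage_le (hh : 0 < h) (u : A) : ‖flowAverage α h u‖ ≤ ‖u‖ := by
  have := intervalIntegral.norm_integral_le_of_norm_le_const (a := 0) (b := h)
    (f := fun s => α s u) (C := ‖u‖) fun s _ => (StarAlgEquiv.norm_map (α s) u).le
  rw [flowAverage, norm_smul, norm_inv, Real.norm_of_nonneg hh.le]
  rw [sub_zero, abs_of_pos hh] at this
  rw [inv_mul_le_iff₀ hh]
  linarith

lemma norm_flowAverage_sub_le (hαcont : ∀ x : A, Continuous fun t : ℝ => α t x) (hh : 0 < h)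
    {u : A} {C : ℝ} (hu : ∀ s ∈ Set.Icc 0 h, ‖α s u - u‖ ≤ C) : ‖flowAverage α h u - u‖ ≤ C := by
  have h1 : flowAverage α h u - u = h⁻¹ • ∫ s in (0 : ℝ)..h, (α s u - u) := by
    rw [intervalIntegral.integral_sub ((hαcont u).intervalIntegrable _ _)
      intervalIntegrable_const, intervalIntegral.integral_const, smul_sub, flowAverage, sub_zero,
      inv_smul_smul₀ hh.ne']
  have := intervalIntegral.norm_integral_le_of_norm_le_const (a := 0) (b := h)
    (f := fun s => α s u - u) (C := C) fun s hs => hu s (by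
      rw [Set.uIoc_of_le hh.le] at hs
      exact Set.Ioc_subset_Icc_self hs)
  rw [h1, norm_smul, norm_inv, Real.norm_of_nonneg hh.le, inv_mul_le_iff₀ hh]
  rw [sub_zero, abs_of_pos hh] at this
  linarith

lemma flow_flowAverage (hαadd : ∀ s t : ℝ, ∀ x : A, α (s + t) x = α s (α t x))
    (hαcont : ∀ x : A, Continuous fun t : ℝ => α t x) (u : A) (t : ℝ) :
    α t (flowAverage α h u) = h⁻¹ • ∫ s in t..(h + t), α s u := by
  let L : A →L[ℝ] A :=
    { toFun := α t
      map_add' := map_add _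
      map_smul' := fun r x => by
        simpa using map_smul (α t) (r : ℂ) x
      cont := (StarAlgEquiv.isometry (α t)).continuous }
  have h1 : ∫ s in (0 : ℝ)..h, L (α s u) = L (∫ s in (0 : ℝ)..h, α s u) :=
    L.intervalIntegral_comp_comm ((hαcont u).intervalIntegrable _ _)
  have h2 : ∫ s in (0 : ℝ)..h, L (α s u) = ∫ s in t..(h + t), α s u := by
    have := intervalIntegral.integral_comp_add_right (a := 0) (b := h) (fun s => α s u) t
    rw [zero_add] at this
    rw [← this]
    exact intervalIntegral.integral_congr fun s _ => by
      change α t (α s u) = α (s + t) u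
      rw [add_comm, hαadd]
  change L (h⁻¹ • ∫ s in (0 : ℝ)..h, α s u) = _
  rw [map_smul, ← h1, h2]

lemma hasDerivAt_flowAverage (hαadd : ∀ s t : ℝ, ∀ x : A, α (s + t) x = α s (α t x))
    (hαcont : ∀ x : A, Continuous fun t : ℝ => α t x) (u : A) :
    HasDerivAt (fun t => α t (flowAverage α h u)) (h⁻¹ • (α h u - α 0 u)) 0 := by
  have hint : ∀ a b, IntervalIntegrable (fun s => α s u) MeasureTheory.volume a b :=
    fun a b => (hαcont u).intervalIntegrable a b
  have hprim : ∀ t, HasDerivAt (fun r => ∫ s in (0 : ℝ)..r, α s u) (α t u) t := fun t =>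
    intervalIntegral.integral_hasDerivAt_right (hint _ _)
      ((hαcont u).stronglyMeasurableAtFilter _ _) (hαcont u).continuousAt
  have h1 : HasDerivAt (fun t => ∫ s in (0 : ℝ)..(h + t), α s u) (α h u) 0 := by
    have := (hprim (h + 0)).comp_const_add h 0
    simpa using this
  refine ((h1.sub (hprim 0)).const_smul h⁻¹).congr_of_eventuallyEq
    (Eventually.of_forall fun t => ?_)
  simp only [Pi.sub_apply, Pi.smul_apply]
  rw [flow_flowAverage hαadd hαcont, intervalIntegral.integral_interval_sub_left (hint _ _)
    (hint _ _)]

lemma tendsto_flowAverage_intertwiner (hα0 : ∀ x : A, α 0 x = x)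
    (hαadd : ∀ s t : ℝ, ∀ x : A, α (s + t) x = α s (α t x))
    (hαcont : ∀ x : A, Continuous fun t : ℝ => α t x) {σ : A ≃⋆ₐ[ℂ] A}
    (hcomm : ∀ t : ℝ, ∀ x : A, σ (α t x) = α t (σ x)) {u : ℕ → A} (hu : ∀ n, u n ∈ unitary A)
    (hlim : ∀ x : A, Tendsto (fun n => ‖u n * x * star (u n) - σ x‖) atTop (𝓝 0)) (x : A) :
    Tendsto (fun n => ‖flowAverage α h (u n) * x - σ x * flowAverage α h (u n)‖)
      atTop (𝓝 0) := by
  have hint : ∀ n, IntervalIntegrable (fun s => α s (u n)) MeasureTheory.volume 0 h :=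
    fun n => (hαcont (u n)).intervalIntegrable 0 h
  have hnorm : ∀ n s, ‖α s (u n) * x - σ x * α s (u n)‖ =
      ‖u n * α (-s) x * star (u n) - σ (α (-s) x)‖ := fun n s => by
    have hs : ∀ z : A, α s (α (-s) z) = z := fun z => by rw [← hαadd, add_neg_cancel, hα0]
    have h1 : α s (u n) * x - σ x * α s (u n) =
        α s (u n * α (-s) x - σ (α (-s) x) * u n) := by
      rw [map_sub, map_mul, map_mul, hs, hcomm, hs]
    rw [h1, StarAlgEquiv.norm_map,
      ← CStarRing.norm_mul_mem_unitary (u n * α (-s) x * star (u n) - σ (α (-s) x)) (hu n),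
      sub_mul, mul_assoc _ (star (u n)) (u n), Unitary.star_mul_self_of_mem (hu n), mul_one]
  have hlim' : Tendsto (fun n => ∫ s in (0 : ℝ)..h, (α s (u n) * x - σ x * α s (u n))) atTop
      (𝓝 (∫ _ in (0 : ℝ)..h, (0 : A))) := by
    refine intervalIntegral.tendsto_integral_filter_of_dominated_convergence
      (fun _ => ‖x‖ + ‖σ x‖) (Eventually.of_forall fun n => ?_)
      (Eventually.of_forall fun n => Eventually.of_forall fun s _ => ?_)
      intervalIntegrable_const (Eventually.of_forall fun s _ => ?_)
    · exact (((hαcont (u n)).mul continuous_const).sub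
        (continuous_const.mul (hαcont (u n)))).aestronglyMeasurable
    · have h1 : ‖α s (u n)‖ ≤ 1 := by
        rw [StarAlgEquiv.norm_map]
        exact norm_le_one_of_mem_unitary (hu n)
      have h2 : ‖α s (u n) * x‖ ≤ 1 * ‖x‖ := (norm_mul_le _ _).trans (by gcongr)
      have h3 : ‖σ x * α s (u n)‖ ≤ ‖σ x‖ * 1 := (norm_mul_le _ _).trans (by gcongr)
      have := norm_sub_le (α s (u n) * x) (σ x * α s (u n))
      linarith
    · rw [tendsto_zero_iff_norm_tendsto_zero]
      simpa only [hnorm] using hlim (α (-s) x)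
  have heq : ∀ n, flowAverage α h (u n) * x - σ x * flowAverage α h (u n) =
      h⁻¹ • ∫ s in (0 : ℝ)..h, (α s (u n) * x - σ x * α s (u n)) := fun n => by
    have hr : IntervalIntegrable (fun s => α s (u n) * x) MeasureTheory.volume 0 h :=
      ((hαcont (u n)).mul continuous_const).intervalIntegrable _ _
    have hl : IntervalIntegrable (fun s => σ x * α s (u n)) MeasureTheory.volume 0 h :=
      (continuous_const.mul (hαcont (u n))).intervalIntegrable _ _
    rw [intervalIntegral.integral_sub hr hl, smul_sub, flowAverage]
    have h1 := ((ContinuousLinearMap.mul ℝ A).flip x).intervalIntegral_comp_comm (hint n)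
    have h2 := (ContinuousLinearMap.mul ℝ A (σ x)).intervalIntegral_comp_comm (hint n)
    simp only [ContinuousLinearMap.flip_apply, ContinuousLinearMap.mul_apply'] at h1 h2
    rw [h1, h2, smul_mul_assoc, mul_smul_comm]
  simp only [heq]
  have := (hlim'.const_smul h⁻¹).norm
  simpa using this

lemma norm_flow_sub_flow_le (hαadd : ∀ s t : ℝ, ∀ x : A, α (s + t) x = α s (α t x))
    {x d : A} (hd : HasDerivAt (fun t => α t x) d 0) (s t : ℝ) :
    ‖α s x - α t x‖ ≤ ‖d‖ * |s - t| := by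
  have hderiv : ∀ r, HasDerivAt (fun t => α t x) (α r d) r := fun r => by
    let L : A →L[ℝ] A :=
      { toFun := α r
        map_add' := map_add _
        map_smul' := fun c y => by
          simpa using map_smul (α r) (c : ℂ) y
        cont := (StarAlgEquiv.isometry (α r)).continuous }
    have h1 : HasDerivAt (fun t => α r (α t x)) (α r d) 0 :=
      L.hasFDerivAt.comp_hasDerivAt 0 hd
    have h2 : HasDerivAt (fun t => α (r + t) x) (α r d) 0 := by
      simpa only [hαadd] using h1
    have h3 : HasDerivAt (fun t => α (r + t) x) (α r d) (r - r) := by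
      simpa using h2
    have := h3.comp_sub_const r r
    simpa using this
  exact convex_univ.norm_image_sub_le_of_norm_hasDerivWithin_le
    (fun r _ => (hderiv r).hasDerivWithinAt) (fun r _ => (StarAlgEquiv.norm_map (α r) d).le)
    (Set.mem_univ t) (Set.mem_univ s)

end Flow

end CStarAlgebra

lemma hasGenDeriv_iff_hasDerivAt {A : Type*} [CStarAlgebra A] {α : ℝ → A ≃⋆ₐ[ℂ] A}
    (hα0 : ∀ x : A, α 0 x = x) {x y : A} :
    HasGenDeriv α x y ↔ HasDerivAt (fun t => α t x) y 0 := by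
  rw [hasDerivAt_iff_tendsto_slope_zero, HasGenDeriv]
  simp only [zero_add, hα0]

/-- For a flow `α` on a unital C*-algebra `A` and an automorphism
`σ` commuting with `α`, the two formulations of "`σ` is `α`-smoothly approximately
inner" are equivalent. -/
theorem smoothly_approximately_inner_iff {A : Type*} [NormedRing A] [StarRing A]
    [CStarRing A] [NormedAlgebra ℂ A] [CompleteSpace A] [StarModule ℂ A]
    (α : ℝ → A ≃⋆ₐ[ℂ] A)
    (hα0 : ∀ x : A, α 0 x = x)
    (hαadd : ∀ s t : ℝ, ∀ x : A, α (s + t) x = α s (α t x))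
    (hαcont : ∀ x : A, Continuous fun t : ℝ => α t x)
    (σ : A ≃⋆ₐ[ℂ] A)
    (hcomm : ∀ t : ℝ, ∀ x : A, σ (α t x) = α t (σ x)) :
    -- (1) unitaries in the generator domain with uniformly bounded derivatives
    (∃ (u : ℕ → A) (d : ℕ → A), (∀ n, u n ∈ unitary A) ∧
        (∀ n, HasGenDeriv α (u n) (d n)) ∧
        (∀ x : A, Tendsto (fun n => ‖u n * x * star (u n) - σ x‖) atTop (𝓝 0)) ∧
        (∃ M : ℝ, ∀ n, ‖d n‖ ≤ M)) ↔
    -- (2) unitaries with `t ↦ α_t(u_n)` equicontinuous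
    (∃ u : ℕ → A, (∀ n, u n ∈ unitary A) ∧
        (∀ x : A, Tendsto (fun n => ‖u n * x * star (u n) - σ x‖) atTop (𝓝 0)) ∧
        (∀ ε : ℝ, 0 < ε → ∃ δ : ℝ, 0 < δ ∧ ∀ n : ℕ, ∀ s t : ℝ, |s - t| < δ →
          ‖α s (u n) - α t (u n)‖ < ε)) := by
  let _ : CStarAlgebra A := {}
  constructor
  · rintro ⟨u, d, hu, hd, hlim, M, hM⟩
    refine ⟨u, hu, hlim, fun ε hε => ⟨ε / (|M| + 1), by positivity, fun n s t hst => ?_⟩⟩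
    have h1 := norm_flow_sub_flow_le hαadd ((hasGenDeriv_iff_hasDerivAt hα0).1 (hd n)) s t
    rw [lt_div_iff₀ (by positivity)] at hst
    have h2 : ‖d n‖ * |s - t| ≤ (|M| + 1) * |s - t| := by
      gcongr
      linarith [hM n, le_abs_self M]
    linarith
  · rintro ⟨u, hu, hlim, heq⟩
    obtain ⟨δ, hδ, hδu⟩ := heq (1 / 4) (by norm_num)
    have hh : 0 < δ / 2 := by positivity
    have hv : ∀ n, ‖flowAverage α (δ / 2) (u n)‖ ≤ 1 := fun n =>
      (norm_flowAverage_le hh _).trans (norm_le_one_of_mem_unitary (hu n))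
    have hvu : ∀ n, ‖flowAverage α (δ / 2) (u n) - u n‖ ≤ 1 / 4 := fun n =>
      norm_flowAverage_sub_le hαcont hh fun s hs => by
        have := hδu n s 0 (by rw [sub_zero, abs_of_nonneg hs.1]; linarith [hs.2])
        rw [hα0] at this
        exact this.le
    choose w b hw hwb hbb hb hbu using fun n => exists_unitary_mul_sqrt (hu n) (hv n) (hvu n)
    choose d hd hdn using fun n => exists_hasDerivAt_unitary_part hα0 hαcont (hw n) (hwb n)
      (hbb n) (hb n) (hbu n) (hv n) (hasDerivAt_flowAverage hαadd hαcont (u n))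
    refine ⟨w, d, hw, fun n => (hasGenDeriv_iff_hasDerivAt hα0).2 (hd n), fun x => ?_,
      6 * ((δ / 2)⁻¹ * 2), fun n => (hdn n).trans ?_⟩
    · have hx := tendsto_flowAverage_intertwiner (h := δ / 2) hα0 hαadd hαcont hcomm hu hlim
      have := ((hx x).const_mul 4).add ((hx (star x)).const_mul 2)
      simp only [mul_zero, add_zero] at this
      refine squeeze_zero (fun n => norm_nonneg _) (fun n => ?_) this
      rw [map_star]
      exact norm_unitary_intertwiner_le (hw n) (hwb n) (hbb n) (hb n) (hv n) x (σ x)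
    · rw [norm_smul, norm_inv, Real.norm_of_nonneg hh.le]
      have h1 := norm_sub_le (α (δ / 2) (u n)) (α 0 (u n))
      rw [StarAlgEquiv.norm_map, StarAlgEquiv.norm_map] at h1
      have h2 := norm_le_one_of_mem_unitary (hu n)
      gcongr
      linarith
end

section
/- Let A be a unital C*-algebra, let α be a flow on A, and let (u_n) be a sequence of unitaries of A such that for every t ∈ ℝ one has ‖α_t(u_n) − u_n‖ → 0 as n → ∞. Then for every compact subset K of ℝ, sup_{t ∈ K} ‖α_t(u_n) − u_n‖ → 0 as n → ∞; that is, the convergence is uniform in t on every compact subset of ℝ. -/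
open Filter Topology

/-- A pointwise null sequence of continuous subadditive functions on a Baire topological group is
eventually uniformly small near `0`. -/
lemma exists_nhds_zero_eventually_forall_lt_of_subadditive {G : Type*} [AddCommGroup G]
    [TopologicalSpace G] [IsTopologicalAddGroup G] [BaireSpace G] {g : ℕ → G → ℝ}
    (hcont : ∀ n, Continuous (g n)) (hadd : ∀ n s t, g n (s + t) ≤ g n s + g n t)
    (hlim : ∀ t, Tendsto (fun n => g n t) atTop (𝓝 0)) {ε : ℝ} (hε : 0 < ε) :
    ∃ U ∈ 𝓝 (0 : G), ∀ᶠ n in atTop, ∀ t ∈ U, g n t < ε := by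
  let F : ℕ → Set G := fun N => ⋂ n ≥ N, {t | g n t ≤ ε / 2}
  have hF : ∀ N, IsClosed (F N) := fun N =>
    isClosed_biInter fun n _ => isClosed_le (hcont n) continuous_const
  have hcover : ⋃ N, F N = Set.univ := by
    refine Set.eq_univ_of_forall fun t => ?_
    obtain ⟨N, hN⟩ := eventually_atTop.1 ((hlim t).eventually_le_const (half_pos hε))
    exact Set.mem_iUnion.2 ⟨N, Set.mem_iInter₂.2 hN⟩
  obtain ⟨N, t₀, ht₀⟩ := nonempty_interior_of_iUnion_of_closed hF hcover
  refine ⟨(t₀ + ·) ⁻¹' F N, ?_, ?_⟩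
  · refine (continuous_const_add t₀).continuousAt.preimage_mem_nhds ?_
    simpa using mem_interior_iff_mem_nhds.1 ht₀
  · filter_upwards [eventually_ge_atTop N, (hlim (-t₀)).eventually_lt_const (half_pos hε)]
      with n hn hlt t ht
    have hle : g n (t₀ + t) ≤ ε / 2 := Set.mem_iInter₂.1 ht n hn
    have := hadd n (-t₀) (t₀ + t)
    rw [neg_add_cancel_left] at this
    linarith

/-- A pointwise null sequence of continuous subadditive functions on a Baire topological group is
eventually uniformly small on every compact set. -/
lemma IsCompact.eventually_forall_lt_of_subadditive {G : Type*} [AddCommGroup G]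
    [TopologicalSpace G] [IsTopologicalAddGroup G] [BaireSpace G] {K : Set G} (hK : IsCompact K)
    {g : ℕ → G → ℝ} (hcont : ∀ n, Continuous (g n))
    (hadd : ∀ n s t, g n (s + t) ≤ g n s + g n t)
    (hlim : ∀ t, Tendsto (fun n => g n t) atTop (𝓝 0)) {ε : ℝ} (hε : 0 < ε) :
    ∀ᶠ n in atTop, ∀ t ∈ K, g n t < ε := by
  obtain ⟨U, hU, hgU⟩ := exists_nhds_zero_eventually_forall_lt_of_subadditive hcont hadd hlim
    (half_pos hε)
  refine hK.induction_on (p := fun S => ∀ᶠ n in atTop, ∀ t ∈ S, g n t < ε) (by simp)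
    (fun S T hST hT => hT.mono fun n hn t ht => hn t (hST ht)) (fun S T hS hT => ?_)
    (fun x _ => ?_)
  · filter_upwards [hS, hT] with n hn hn' t ht using ht.elim (hn t) (hn' t)
  · refine ⟨(-x + ·) ⁻¹' U, mem_nhdsWithin_of_mem_nhds ?_, ?_⟩
    · exact (continuous_const_add (-x)).continuousAt.preimage_mem_nhds (by simpa using hU)
    · filter_upwards [hgU, (hlim x).eventually_lt_const (half_pos hε)] with n hn hlt t ht
      have h₁ : g n (-x + t) < ε / 2 := hn _ ht
      have := hadd n x (-x + t)
      rw [add_neg_cancel_left] at this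
      linarith

open Filter Topology

/-- If `(u_n)` is a sequence of unitaries in a unital C*-algebra
with a flow `α` such that `‖α_t(u_n) - u_n‖ → 0` for every `t ∈ ℝ`, then the
convergence is uniform in `t` on every compact subset of `ℝ`. -/
theorem tendsto_uniformly_on_compact_of_pointwise {A : Type*} [NormedRing A]
    [StarRing A] [CStarRing A] [NormedAlgebra ℂ A] [CompleteSpace A] [StarModule ℂ A]
    (α : ℝ → A ≃⋆ₐ[ℂ] A)
    (hα0 : ∀ x : A, α 0 x = x)
    (hαadd : ∀ s t : ℝ, ∀ x : A, α (s + t) x = α s (α t x))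
    (hαcont : ∀ x : A, Continuous fun t : ℝ => α t x)
    (u : ℕ → A) (hu : ∀ n, u n ∈ unitary A)
    (hconv : ∀ t : ℝ, Tendsto (fun n => ‖α t (u n) - u n‖) atTop (𝓝 0)) :
    ∀ K : Set ℝ, IsCompact K → ∀ ε : ℝ, 0 < ε → ∃ N : ℕ, ∀ n ≥ N, ∀ t ∈ K,
      ‖α t (u n) - u n‖ < ε := by
  intro K hK ε hε
  let _ : CStarAlgebra A := { }
  refine eventually_atTop.1 (hK.eventually_forall_lt_of_subadditive
    (g := fun n t => ‖α t (u n) - u n‖) (fun n => ?_) (fun n s t => ?_) hconv hε)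
  · exact ((hαcont (u n)).sub continuous_const).norm
  · calc ‖α (s + t) (u n) - u n‖ = ‖(α s (u n) - u n) + α s (α t (u n) - u n)‖ := by
          rw [hαadd, map_sub]; congr 1; abel
      _ ≤ ‖α s (u n) - u n‖ + ‖α s (α t (u n) - u n)‖ := norm_add_le _ _
      _ = ‖α s (u n) - u n‖ + ‖α t (u n) - u n‖ := by rw [StarAlgEquiv.norm_map]
end
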